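/- arXiv:math/0510093 — 3 statements merged into one kernel-verified Lean document; each statement's English description precedes it below -/
import Mathlib

section
/- Let p, n be natural numbers with 2 ≤ p ≤ n−2. An element ω of the p-th exterior power ⋀^p k^n is decomposable if and only if P'_{A,B,C}(ω) = 0 for every triple (A,B,C) whose indices α_i, β_j^(μ), γ_l are all distinct and satisfy α_i < α_{i+1}, β_i^0 < β_i^1, β_i^ν < β_{i+1}^ν, β_i^0 < α_1, β_i^1 < α_3, and γ_i < γ_{i+1}. -/
open ExteriorAlgebra

noncomputable section

variable (k : Type*) [Field k]

/-- The alternating map giving the coordinate `Π_idx` (antisymmetric in `idx`). -/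
def coordA {n : ℕ} (q : ℕ) (idx : Fin q → Fin n) :
    (Fin n → k) [⋀^Fin q]→ₗ[k] k :=
  (Matrix.detRowAlternating : (Fin q → k) [⋀^Fin q]→ₗ[k] k).compLinearMap
    (LinearMap.funLeft k k idx)

/-- The coordinate functional `Π_idx` on the exterior algebra. -/
def coordF {n : ℕ} (q : ℕ) (idx : Fin q → Fin n) :
    ExteriorAlgebra k (Fin n → k) →ₗ[k] k :=
  ExteriorAlgebra.liftAlternating
    (Function.update (fun i => (0 : (Fin n → k) [⋀^Fin i]→ₗ[k] k)) q (coordA k q idx))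

/-- Decomposability of an element of the exterior algebra, in degree `q`. -/
def IsDecomp {n : ℕ} (q : ℕ) (x : ExteriorAlgebra k (Fin n → k)) : Prop :=
  ∃ v : Fin q → (Fin n → k), x = ExteriorAlgebra.ιMulti k q v

/-- The dual isomorphism `δ` on the degree-`p` part, with values in degree `n-p`. -/
def dualAt (n p : ℕ) (ω : ExteriorAlgebra k (Fin n → k)) :
    ExteriorAlgebra k (Fin n → k) :=
  ∑ s : {s : Finset (Fin n) // s.card = p},
    coordF k p (fun a => (s.1.orderIsoOfFin s.2 a : Fin n)) ω •
      ExteriorAlgebra.ιMulti k (n - p)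
        (fun a => Pi.single (((s.1ᶜ).orderIsoOfFin
          (by rw [Finset.card_compl, s.2, Fintype.card_fin]) a : Fin n)) (1 : k))

/-- The index tuple `(α_i, α_j, β_1^{ε_1}, …, β_m^{ε_m}, γ_1, …, γ_c)`. -/
def tupleP {n : ℕ} (m c : ℕ) (α : Fin 4 → Fin n) (β : Fin m → Fin 2 → Fin n)
    (γ : Fin c → Fin n) (i j : Fin 4) (ε : Fin m → Fin 2) : Fin (2 + (m + c)) → Fin n :=
  Fin.append ![α i, α j] (Fin.append (fun l => β l (ε l)) γ)

/-- The functional `π_{ij} = Π_{α_i α_j β⃗_1 … β⃗_m γ_1 … γ_c}`. -/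
def piF {n : ℕ} (m c : ℕ) (α : Fin 4 → Fin n) (β : Fin m → Fin 2 → Fin n)
    (γ : Fin c → Fin n) (i j : Fin 4) :
    ExteriorAlgebra k (Fin n → k) →ₗ[k] k :=
  ∑ ε : Fin m → Fin 2, coordF k (2 + (m + c)) (tupleP m c α β γ i j ε)

/-- The rank 6 quadratic form `P'_{A,B,C}`. -/
def Pprime {n : ℕ} (m c : ℕ) (α : Fin 4 → Fin n) (β : Fin m → Fin 2 → Fin n)
    (γ : Fin c → Fin n) (ω : ExteriorAlgebra k (Fin n → k)) : k :=
  piF k m c α β γ 0 1 ω * piF k m c α β γ 2 3 ω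
    - piF k m c α β γ 0 2 ω * piF k m c α β γ 1 3 ω
    + piF k m c α β γ 0 3 ω * piF k m c α β γ 1 2 ω

/-- The ordering/distinctness conditions on the triple `(A,B,C)`. -/
def OrderedABC {n : ℕ} (m c : ℕ) (α : Fin 4 → Fin n) (β : Fin m → Fin 2 → Fin n)
    (γ : Fin c → Fin n) : Prop :=
  Function.Injective (Sum.elim α (Sum.elim (fun x : Fin m × Fin 2 => β x.1 x.2) γ)) ∧
    StrictMono α ∧ (∀ l, β l 0 < β l 1) ∧
    (∀ ν : Fin 2, StrictMono fun l => β l ν) ∧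
    (∀ l, β l 0 < α 0) ∧ (∀ l, β l 1 < α 2) ∧ StrictMono γ

/-- The set `S' = A ∪ B_1 ∪ C`. -/
def SP {n : ℕ} (m c : ℕ) (α : Fin 4 → Fin n) (β : Fin m → Fin 2 → Fin n)
    (γ : Fin c → Fin n) : Finset (Fin n) :=
  Finset.univ.image α ∪ Finset.univ.image (fun l => β l 1) ∪ Finset.univ.image γ

open Classical in
/-- The matrix of the map `X_{A,B,C} : k^n → k^{p+2}`. -/
def Xmat (p : ℕ) {n : ℕ} (m c : ℕ) (α : Fin 4 → Fin n) (β : Fin m → Fin 2 → Fin n)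
    (γ : Fin c → Fin n) : Matrix (Fin (p + 2)) (Fin n) k :=
  if h : (SP m c α β γ).card = p + 2 then
    fun j i =>
      (if i = ((SP m c α β γ).orderIsoOfFin h j : Fin n) then 1 else 0) +
        ∑ l : Fin m,
          if i = β l 0 ∧ β l 1 = ((SP m c α β γ).orderIsoOfFin h j : Fin n) then 1 else 0
  else 0

/-- The linear map `X_{A,B,C} : k^n → k^{p+2}`. -/
def XL (p : ℕ) {n : ℕ} (m c : ℕ) (α : Fin 4 → Fin n) (β : Fin m → Fin 2 → Fin n)
    (γ : Fin c → Fin n) : (Fin n → k) →ₗ[k] (Fin (p + 2) → k) :=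
  (Xmat k p m c α β γ).mulVecLin

open Classical in
/-- The matrix of the map `Z : k^{p+2} → k^4`. -/
def Zmat (p : ℕ) {n : ℕ} (m c : ℕ) (α : Fin 4 → Fin n) (β : Fin m → Fin 2 → Fin n)
    (γ : Fin c → Fin n) : Matrix (Fin 4) (Fin (p + 2)) k :=
  fun j i => if XL k p m c α β γ (Pi.single (α j) 1) = Pi.single i 1 then 1 else 0

/-- The linear map `Z : k^{p+2} → k^4`. -/
def ZL (p : ℕ) {n : ℕ} (m c : ℕ) (α : Fin 4 → Fin n) (β : Fin m → Fin 2 → Fin n)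
    (γ : Fin c → Fin n) : (Fin (p + 2) → k) →ₗ[k] (Fin 4 → k) :=
  (Zmat k p m c α β γ).mulVecLin

/-- The Grassmann cone preserving map `G_{A,B,C} = ⋀²Z ∘ δ ∘ ⋀^p X_{A,B,C}`. -/
def GABC (p : ℕ) {n : ℕ} (m c : ℕ) (α : Fin 4 → Fin n) (β : Fin m → Fin 2 → Fin n)
    (γ : Fin c → Fin n) (ω : ExteriorAlgebra k (Fin n → k)) :
    ExteriorAlgebra k (Fin 4 → k) :=
  ExteriorAlgebra.map (ZL k p m c α β γ)
    (dualAt k (p + 2) p (ExteriorAlgebra.map (XL k p m c α β γ) ω))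

/-- The general Plücker quadratic form `P_{A,B}` for index sequences
`a : Fin d → Fin n` and `b : Fin (e+1) → Fin n`. -/
def Pluecker {n : ℕ} (d e : ℕ) (a : Fin d → Fin n) (b : Fin (e + 1) → Fin n)
    (ω : ExteriorAlgebra k (Fin n → k)) : k :=
  ∑ i : Fin (e + 1), (-1 : k) ^ (i : ℕ) *
    (coordF k (d + 1) (Fin.snoc a (b i)) ω * coordF k e (fun j => b (i.succAbove j)) ω)


variable {k} in
/-- The coordinates of a decomposable element are the maximal minors of its matrix. -/
lemma coordF_ιMulti {n q : ℕ} (idx : Fin q → Fin n) (v : Fin q → Fin n → k) :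
    coordF k q idx (ExteriorAlgebra.ιMulti k q v) =
      (Matrix.of fun j i => v i (idx j)).det := by
  rw [coordF, ExteriorAlgebra.liftAlternating_apply_ιMulti, Function.update_self,
    ← Matrix.det_transpose]
  rfl

lemma coordF_congr {n q : ℕ} {idx idx' : Fin q → Fin n} {a : k}
    (h : coordA k q idx = a • coordA k q idx') : coordF k q idx = a • coordF k q idx' := by
  rw [coordF, coordF, ← map_smul, ← Function.update_smul, h]
  congr 2
  funext i
  simp

lemma coordF_comp_perm {n q : ℕ} (idx : Fin q → Fin n) (σ : Equiv.Perm (Fin q)) :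
    coordF k q (idx ∘ σ) = ((Equiv.Perm.sign σ : ℤ) : k) • coordF k q idx := by
  apply coordF_congr
  ext v
  exact Matrix.det_permute' σ (Matrix.of fun i j => v i (idx j))

variable {k} in
lemma injective_of_coordF_ne_zero {n q : ℕ} {idx : Fin q → Fin n}
    {x : ExteriorAlgebra k (Fin n → k)} (h : coordF k q idx x ≠ 0) :
    Function.Injective idx := by
  intro i j hij
  by_contra hne
  apply h
  have : coordF k q idx = (0 : k) • coordF k q idx := by
    apply coordF_congr
    ext v
    rw [zero_smul]
    exact Matrix.det_zero_of_column_eq hne fun l => by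
      change v l (idx i) = v l (idx j)
      rw [hij]
  rw [this]
  simp

/-- Injective tuples with the same image differ by a permutation. -/
lemma exists_perm_of_image_eq {n q : ℕ} {idx idx' : Fin q → Fin n}
    (h : Function.Injective idx) (h' : Function.Injective idx')
    (him : Finset.univ.image idx = Finset.univ.image idx') :
    ∃ σ : Equiv.Perm (Fin q), idx = idx' ∘ σ := by
  have hr : Set.range idx = Set.range idx' := by
    have := congrArg (fun s : Finset (Fin n) => (s : Set (Fin n))) him
    simpa using this
  refine ⟨(Equiv.ofInjective idx h).trans ((Equiv.setCongr hr).trans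
    (Equiv.ofInjective idx' h').symm), ?_⟩
  funext i
  simp [Equiv.apply_ofInjective_symm]

variable {k} in
/-- Whether two coordinates agree depends only on the underlying index set. -/
lemma coordF_eq_iff_of_image_eq {n q : ℕ} {idx idx' : Fin q → Fin n}
    (h : Function.Injective idx) (h' : Function.Injective idx')
    (him : Finset.univ.image idx = Finset.univ.image idx')
    (x y : ExteriorAlgebra k (Fin n → k)) :
    coordF k q idx x = coordF k q idx y ↔ coordF k q idx' x = coordF k q idx' y := by
  obtain ⟨σ, rfl⟩ := exists_perm_of_image_eq h h' him
  rw [coordF_comp_perm]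
  rcases Int.units_eq_one_or (Equiv.Perm.sign σ) with hs | hs <;> simp [hs]

variable {k} in
lemma coordF_ne_zero_iff_of_image_eq {n q : ℕ} {idx idx' : Fin q → Fin n}
    (h : Function.Injective idx) (h' : Function.Injective idx')
    (him : Finset.univ.image idx = Finset.univ.image idx')
    (x : ExteriorAlgebra k (Fin n → k)) :
    coordF k q idx x ≠ 0 ↔ coordF k q idx' x ≠ 0 := by
  simpa using not_congr (coordF_eq_iff_of_image_eq h h' him x 0)

variable {k} in
/-- An element of the exterior power is determined by its coordinates. -/
lemma eq_of_coordF_eq {n q : ℕ} (x y : ⋀[k]^q (Fin n → k))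
    (h : ∀ idx : Fin q → Fin n, Function.Injective idx →
      coordF k q idx x.val = coordF k q idx y.val) : x = y := by
  let b := Pi.basisFun k (Fin n)
  have key : ∀ s : Set.powersetCard (Fin n) q, exteriorPower.ιMultiDual k q b s =
      coordF k q (Set.powersetCard.ofFinEmbEquiv.symm s) ∘ₗ (⋀[k]^q (Fin n → k)).subtype := by
    intro s
    apply exteriorPower.linearMap_ext
    ext v
    simp only [LinearMap.compAlternatingMap_apply, LinearMap.comp_apply]
    rw [exteriorPower.ιMultiDual_apply_ιMulti]
    simp only [Submodule.subtype_apply, exteriorPower.ιMulti_apply_coe]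
    rw [coordF_ιMulti, ← Matrix.det_transpose]
    rfl
  apply (b.exteriorPower q).repr.injective
  ext s
  rw [exteriorPower.basis_repr_apply, exteriorPower.basis_repr_apply, key]
  exact h _ (Set.powersetCard.ofFinEmbEquiv.symm s).injective

/-- Cramer's rule: the linear relation between `q + 1` vectors of `k^q`. -/
lemma sum_det_succAbove_smul {R : Type*} [CommRing R] {q : ℕ} (b : Fin (q + 1) → Fin q → R) :
    ∑ i : Fin (q + 1),
      ((-1 : R) ^ (i : ℕ) * (Matrix.of fun j => b (i.succAbove j)).det) • b i = 0 := by
  funext l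
  have h0 : (Matrix.of fun i => (Fin.cons (b i l) (b i) : Fin (q + 1) → R)).det = 0 :=
    Matrix.det_zero_of_column_eq (Fin.succ_ne_zero l).symm fun i => by simp
  rw [Matrix.det_succ_column_zero] at h0
  rw [Finset.sum_apply, Pi.zero_apply, ← h0]
  refine Finset.sum_congr rfl fun i _ => ?_
  have : (Matrix.of fun j => b (i.succAbove j)) =
      (Matrix.of fun i => (Fin.cons (b i l) (b i) : Fin (q + 1) → R)).submatrix
        i.succAbove Fin.succ := by
    ext a c
    simp
  rw [← this]
  simp
  ring

/-- The three-term Plücker relation for determinants. -/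
lemma det_three_term {R : Type*} [CommRing R] {r : ℕ} (a : Fin 4 → Fin (r + 2) → R)
    (F : Fin r → Fin (r + 2) → R) :
    let D : (Fin (r + 2) → R) → (Fin (r + 2) → R) → R := fun x y =>
      (Matrix.of (Fin.cons x (Fin.cons y F : Fin (r + 1) → Fin (r + 2) → R) :
        Fin (r + 2) → Fin (r + 2) → R)).det
    D (a 0) (a 1) * D (a 2) (a 3) - D (a 0) (a 2) * D (a 1) (a 3)
      + D (a 0) (a 3) * D (a 1) (a 2) = 0 := by
  intro D
  let L : (Fin (r + 2) → R) →ₗ[R] R :=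
    (Matrix.detRowAlternating (n := Fin (r + 2)) (R := R)).toMultilinearMap.toLinearMap
      (Fin.cons (a 0) (Fin.cons 0 F : Fin (r + 1) → Fin (r + 2) → R)) 1
  have hL : ∀ y, L y = D (a 0) y := by
    intro y
    change Matrix.det _ = Matrix.det _
    congr 1
    funext i
    refine Fin.cases ?_ (fun i => ?_) i
    · rfl
    · refine Fin.cases ?_ (fun i => ?_) i
      · exact Function.update_self _ _ _
      · exact Function.update_of_ne (by simp [Fin.ext_iff]) _ _
  have hLF : ∀ i, D (a 0) (F i) = 0 := fun i =>
    Matrix.det_zero_of_row_eq (i := 1) (j := i.succ.succ) (by simp [Fin.ext_iff]) rfl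
  have hc := congrArg L (sum_det_succAbove_smul
    (Fin.cons (a 1) (Fin.cons (a 2) (Fin.cons (a 3) F : Fin (r + 1) → Fin (r + 2) → R) :
      Fin (r + 2) → Fin (r + 2) → R)))
  simp only [map_sum, map_smul, map_zero, smul_eq_mul] at hc
  simp only [hL] at hc
  rw [Fin.sum_univ_succ, Fin.sum_univ_succ, Fin.sum_univ_succ] at hc
  have e0 : ∀ x y z : Fin (r + 2) → R, (fun j => (Fin.cons x (Fin.cons y (Fin.cons z F :
      Fin (r + 1) → Fin (r + 2) → R) : Fin (r + 2) → Fin (r + 2) → R) :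
      Fin (r + 3) → Fin (r + 2) → R) ((0 : Fin (r + 3)).succAbove j)) =
      Fin.cons y (Fin.cons z F : Fin (r + 1) → Fin (r + 2) → R) := by
    intro x y z
    funext j
    simp
  have e1 : ∀ x y z : Fin (r + 2) → R, (fun j => (Fin.cons x (Fin.cons y (Fin.cons z F :
      Fin (r + 1) → Fin (r + 2) → R) : Fin (r + 2) → Fin (r + 2) → R) :
      Fin (r + 3) → Fin (r + 2) → R) ((Fin.succ 0 : Fin (r + 3)).succAbove j)) =
      Fin.cons x (Fin.cons z F : Fin (r + 1) → Fin (r + 2) → R) := by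
    intro x y z
    funext j
    refine Fin.cases ?_ (fun j => ?_) j <;> simp
  have e2 : ∀ x y z : Fin (r + 2) → R, (fun j => (Fin.cons x (Fin.cons y (Fin.cons z F :
      Fin (r + 1) → Fin (r + 2) → R) : Fin (r + 2) → Fin (r + 2) → R) :
      Fin (r + 3) → Fin (r + 2) → R) ((Fin.succ (Fin.succ 0) : Fin (r + 3)).succAbove j)) =
      Fin.cons x (Fin.cons y F : Fin (r + 1) → Fin (r + 2) → R) := by
    intro x y z
    funext j
    refine Fin.cases ?_ (fun j => ?_) j
    · simp only [Fin.succ_succAbove_zero, Fin.cons_zero]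
    · refine Fin.cases ?_ (fun j => ?_) j <;>
        simp only [Fin.succ_succAbove_zero, Fin.succ_succAbove_succ, Fin.succAbove_zero,
          Fin.cons_zero, Fin.cons_succ]
  simp only [e0, e1, e2, Fin.cons_succ, Fin.cons_zero, hLF, mul_zero, Finset.sum_const_zero,
    Fin.val_zero, Fin.val_succ, pow_zero, zero_add, pow_one] at hc
  change 1 * D (a 2) (a 3) * D (a 0) (a 1) + (-1 * D (a 1) (a 3) * D (a 0) (a 2) +
    ((-1) ^ (1 + 1) * D (a 1) (a 2) * D (a 0) (a 3) + 0)) = 0 at hc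
  linear_combination hc

lemma append_update_right {A : Type*} {a b : ℕ} (f : Fin a → A) (g : Fin b → A) (i : Fin b)
    (x : A) : Fin.append f (Function.update g i x) =
      Function.update (Fin.append f g) (Fin.natAdd a i) x := by
  funext j
  refine Fin.addCases (fun j => ?_) (fun j => ?_) j
  · rw [Function.update_of_ne (by simp [Fin.ext_iff]; omega)]
    simp
  · rcases eq_or_ne j i with rfl | h
    · simp
    · rw [Function.update_of_ne (by simpa [Fin.ext_iff] using h)]
      simp [h]

lemma append_update_left {A : Type*} {a b : ℕ} (f : Fin a → A) (g : Fin b → A) (i : Fin a)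
    (x : A) : Fin.append (Function.update f i x) g =
      Function.update (Fin.append f g) (Fin.castAdd b i) x := by
  funext j
  refine Fin.addCases (fun j => ?_) (fun j => ?_) j
  · rcases eq_or_ne j i with rfl | h
    · simp
    · rw [Function.update_of_ne (by simpa [Fin.ext_iff] using h)]
      simp [h]
  · rw [Function.update_of_ne (by simp [Fin.ext_iff]; omega)]
    simp

/-- Multilinear expansion of an alternating map in a middle block of arguments. -/
lemma alternatingMap_append_sum {R V : Type*} [CommRing R] [AddCommGroup V] [Module R V]
    {a m c : ℕ} (D : V [⋀^Fin (a + (m + c))]→ₗ[R] R) (f : Fin a → V) (h : Fin c → V)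
    (g : Fin m → Fin 2 → V) :
    D (Fin.append f (Fin.append (fun l => ∑ e, g l e) h)) =
      ∑ ε : Fin m → Fin 2, D (Fin.append f (Fin.append (fun l => g l (ε l)) h)) := by
  let M : MultilinearMap R (fun _ : Fin m => V) R :=
    { toFun := fun x => D (Fin.append f (Fin.append x h))
      map_update_add' := by
        intro inst x i y z
        rw [Subsingleton.elim inst (instDecidableEqFin m)]
        simp only [append_update_left, append_update_right, AlternatingMap.map_update_add]
      map_update_smul' := by
        intro inst x i y z
        rw [Subsingleton.elim inst (instDecidableEqFin m)]
        simp only [append_update_left, append_update_right, AlternatingMap.map_update_smul] }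
  exact M.map_sum g

variable {k} in
lemma piF_ιMulti {n m c : ℕ} (α : Fin 4 → Fin n) (β : Fin m → Fin 2 → Fin n) (γ : Fin c → Fin n)
    (i j : Fin 4) (v : Fin (2 + (m + c)) → Fin n → k) :
    piF k m c α β γ i j (ExteriorAlgebra.ιMulti k _ v) =
      (Matrix.of (Fin.append ![fun l => v l (α i), fun l => v l (α j)]
        (Fin.append (fun a l => ∑ e, v l (β a e)) fun b l => v l (γ b)))).det := by
  have := alternatingMap_append_sum
    (Matrix.detRowAlternating (n := Fin (2 + (m + c))) (R := k))
    ![fun l => v l (α i), fun l => v l (α j)] (fun b l => v l (γ b))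
    (fun a e l => v l (β a e))
  rw [piF, LinearMap.sum_apply]
  simp only [coordF_ιMulti]
  refine Eq.trans (b := ∑ ε : Fin m → Fin 2, Matrix.detRowAlternating
    (Fin.append ![fun l => v l (α i), fun l => v l (α j)]
      (Fin.append (fun a l => v l (β a (ε a))) fun b l => v l (γ b)))) ?_ ?_
  · refine Finset.sum_congr rfl fun ε _ => ?_
    change Matrix.det _ = Matrix.det _
    congr 1
    funext x
    refine Fin.addCases (fun x => ?_) (fun x => ?_) x
    · fin_cases x <;> simp [tupleP] <;> rfl
    · refine Fin.addCases (fun x => ?_) (fun x => ?_) x <;> funext l <;> simp [tupleP]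
  · rw [← this]
    change Matrix.det _ = Matrix.det _
    congr 3

variable {k} in
/-- The forms `P'` vanish on decomposable elements. -/
lemma Pprime_ιMulti {n m c : ℕ} (α : Fin 4 → Fin n) (β : Fin m → Fin 2 → Fin n)
    (γ : Fin c → Fin n) (v : Fin (2 + (m + c)) → Fin n → k) :
    Pprime k m c α β γ (ExteriorAlgebra.ιMulti k _ v) = 0 := by
  let e : Fin (m + c + 2) ≃ Fin (2 + (m + c)) := finCongr (by omega)
  let F : Fin (m + c) → Fin (m + c + 2) → k := fun a =>
    (Fin.append (fun a l => ∑ e, v l (β a e)) fun b l => v l (γ b) :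
      Fin (m + c) → Fin (2 + (m + c)) → k) a ∘ e
  have key : ∀ i j, piF k m c α β γ i j (ExteriorAlgebra.ιMulti k _ v) =
      (Matrix.of (Fin.cons (fun l => v (e l) (α i))
        (Fin.cons (fun l => v (e l) (α j)) F : Fin (m + c + 1) → Fin (m + c + 2) → k) :
          Fin (m + c + 2) → Fin (m + c + 2) → k)).det := by
    intro i j
    rw [piF_ιMulti, ← Matrix.det_submatrix_equiv_self e]
    congr 1
    funext x
    refine Fin.cases ?_ (fun x => ?_) x
    · funext l
      rfl
    · refine Fin.cases ?_ (fun x => ?_) x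
      · funext l
        rfl
      · have hx : e x.succ.succ = Fin.natAdd 2 x := by
          apply Fin.ext
          simp [e]
          omega
        funext l
        rw [Matrix.submatrix_apply, hx]
        simp [F]
  have := det_three_term (fun i l => v (e l) (α i)) F
  simp only [← key] at this
  exact this

variable {k} in
/-- The index set `X` carries a nonzero coordinate of `x`. -/
def IsSupp {n : ℕ} (q : ℕ) (x : ExteriorAlgebra k (Fin n → k)) (X : Finset (Fin n)) : Prop :=
  ∃ idx : Fin q → Fin n, Finset.univ.image idx = X ∧ coordF k q idx x ≠ 0

variable {k} in
lemma IsSupp.card_eq {n q : ℕ} {x : ExteriorAlgebra k (Fin n → k)} {X : Finset (Fin n)}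
    (h : IsSupp q x X) : X.card = q := by
  obtain ⟨idx, rfl, h⟩ := h
  rw [Finset.card_image_of_injective _ (injective_of_coordF_ne_zero h), Finset.card_fin]

variable {k} in
lemma IsSupp.coordF_ne_zero {n q : ℕ} {x : ExteriorAlgebra k (Fin n → k)} {X : Finset (Fin n)}
    (h : IsSupp q x X) {idx : Fin q → Fin n} (hidx : Function.Injective idx)
    (hX : Finset.univ.image idx = X) : coordF k q idx x ≠ 0 := by
  obtain ⟨idx', h', h⟩ := h
  exact (coordF_ne_zero_iff_of_image_eq (injective_of_coordF_ne_zero h) hidx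
    (h'.trans hX.symm) x).1 h

lemma tupleP_injective {n m c : ℕ} {α : Fin 4 → Fin n} {β : Fin m → Fin 2 → Fin n}
    {γ : Fin c → Fin n}
    (h : Function.Injective (Sum.elim α (Sum.elim (fun x : Fin m × Fin 2 => β x.1 x.2) γ)))
    {i j : Fin 4} (hij : i ≠ j) (ε : Fin m → Fin 2) :
    Function.Injective (tupleP m c α β γ i j ε) := by
  let f : Fin (2 + (m + c)) → Fin 4 ⊕ (Fin m × Fin 2 ⊕ Fin c) :=
    Fin.append (fun a => Sum.inl (![i, j] a))
      (Fin.append (fun l => Sum.inr (Sum.inl (l, ε l))) fun b => Sum.inr (Sum.inr b))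
  have hf : tupleP m c α β γ i j ε =
      Sum.elim α (Sum.elim (fun x : Fin m × Fin 2 => β x.1 x.2) γ) ∘ f := by
    funext x
    refine Fin.addCases (fun x => ?_) (fun x => ?_) x
    · fin_cases x <;> simp [tupleP, f]
    · refine Fin.addCases (fun x => ?_) (fun x => ?_) x <;> simp [tupleP, f]
  rw [hf]
  refine h.comp ?_
  intro x y
  refine Fin.addCases (fun x => ?_) (fun x => ?_) x <;>
    refine Fin.addCases (fun y => ?_) (fun y => ?_) y
  · fin_cases x <;> fin_cases y <;> simp [f, hij, hij.symm]
  · refine Fin.addCases (fun y => ?_) (fun y => ?_) y <;> simp [f]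
  · refine Fin.addCases (fun x => ?_) (fun x => ?_) x <;> simp [f]
  · refine Fin.addCases (fun x => ?_) (fun x => ?_) x <;>
      refine Fin.addCases (fun y => ?_) (fun y => ?_) y <;> simp +contextual [f, Fin.ext_iff]

lemma mem_image_tupleP {n m c : ℕ} {α : Fin 4 → Fin n} {β : Fin m → Fin 2 → Fin n}
    {γ : Fin c → Fin n} {i j : Fin 4} {ε : Fin m → Fin 2} {x : Fin n} :
    x ∈ Finset.univ.image (tupleP m c α β γ i j ε) ↔
      x = α i ∨ x = α j ∨ (∃ l, x = β l (ε l)) ∨ ∃ b, x = γ b := by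
  constructor
  · intro hx
    obtain ⟨y, -, rfl⟩ := Finset.mem_image.1 hx
    refine Fin.addCases (fun y => ?_) (fun y => ?_) y
    · fin_cases y <;> simp [tupleP]
    · refine Fin.addCases (fun y => ?_) (fun y => ?_) y
      · exact Or.inr (Or.inr (Or.inl ⟨y, by simp [tupleP]⟩))
      · exact Or.inr (Or.inr (Or.inr ⟨y, by simp [tupleP]⟩))
  · rintro (rfl | rfl | ⟨l, rfl⟩ | ⟨b, rfl⟩) <;> rw [Finset.mem_image]
    · exact ⟨Fin.castAdd _ 0, Finset.mem_univ _, by simp [tupleP]⟩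
    · exact ⟨Fin.castAdd _ 1, Finset.mem_univ _, by simp [tupleP]⟩
    · exact ⟨Fin.natAdd 2 (Fin.castAdd _ l), Finset.mem_univ _, by simp [tupleP]⟩
    · exact ⟨Fin.natAdd 2 (Fin.natAdd _ b), Finset.mem_univ _, by simp [tupleP]⟩

/-- Pairing the elements of `S \ T` and `T \ S` in increasing order gives an ordered triple whose
pairs `β` are separated by `S` and `T`. -/
lemma exists_orderedABC {n m c : ℕ} {S T : Finset (Fin n)} (hS : (S \ T).card = m + 2)
    (hT : (T \ S).card = m + 2) (hc : (S ∩ T).card = c) :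
    ∃ (α : Fin 4 → Fin n) (β : Fin m → Fin 2 → Fin n) (γ : Fin c → Fin n),
      OrderedABC m c α β γ ∧ (Finset.univ.filter fun i => α i ∈ S).card = 2 ∧
      (∀ i, α i ∈ S \ T ∨ α i ∈ T \ S) ∧
      (∀ l, (β l 0 ∈ S \ T ∧ β l 1 ∈ T \ S) ∨ (β l 1 ∈ S \ T ∧ β l 0 ∈ T \ S)) ∧
      ∀ b, γ b ∈ S ∩ T := by
  let s := (S \ T).orderEmbOfFin hS
  let t := (T \ S).orderEmbOfFin hT
  let γ := (S ∩ T).orderEmbOfFin hc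
  have hs : ∀ i, s i ∈ S \ T := Finset.orderEmbOfFin_mem _ hS
  have ht : ∀ i, t i ∈ T \ S := Finset.orderEmbOfFin_mem _ hT
  have hγ : ∀ i, γ i ∈ S ∩ T := Finset.orderEmbOfFin_mem _ hc
  have hst : ∀ i j, s i ≠ t j := fun i j h => by
    have h1 := Finset.mem_sdiff.1 (hs i)
    have h2 := Finset.mem_sdiff.1 (ht j)
    rw [h] at h1
    exact h1.2 h2.1
  let u : Fin (m + 2) := Fin.natAdd m 0
  let w : Fin (m + 2) := Fin.natAdd m 1
  have huw : u < w := by simp [u, w, Fin.lt_def]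
  have hlu : ∀ l : Fin m, Fin.castAdd 2 l < u := fun l => by simp [u, Fin.lt_def]
  let A : Finset (Fin n) := {s u, s w, t u, t w}
  have hsu : s u < s w := s.strictMono huw
  have htu : t u < t w := t.strictMono huw
  have hA : A.card = 4 := by
    simp only [A]
    rw [Finset.card_insert_of_notMem, Finset.card_insert_of_notMem, Finset.card_insert_of_notMem,
      Finset.card_singleton]
    · simpa using htu.ne
    · simp [hst]
    · simp [hst, hsu.ne]
  let α := A.orderEmbOfFin hA
  have hα : ∀ i, α i = s u ∨ α i = s w ∨ α i = t u ∨ α i = t w := fun i => by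
    have : α i ∈ A := Finset.orderEmbOfFin_mem _ hA i
    simpa only [A, Finset.mem_insert, Finset.mem_singleton] using this
  have hα' : ∀ x ∈ A, ∃ i, α i = x := fun x hx => by
    have := Finset.range_orderEmbOfFin A hA
    have hx' : x ∈ Set.range (A.orderEmbOfFin hA) := by rw [this]; exact hx
    exact hx'
  have hαi : ∀ i, α i ∈ S \ T ∨ α i ∈ T \ S := fun i => by
    rcases hα i with h | h | h | h <;> rw [h] <;> simp only [hs, ht, true_or, or_true]
  let β : Fin m → Fin 2 → Fin n := fun l =>
    ![min (s (Fin.castAdd 2 l)) (t (Fin.castAdd 2 l)),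
      max (s (Fin.castAdd 2 l)) (t (Fin.castAdd 2 l))]
  have hβ : ∀ l, (β l 0 = s (Fin.castAdd 2 l) ∧ β l 1 = t (Fin.castAdd 2 l) ∧
        s (Fin.castAdd 2 l) < t (Fin.castAdd 2 l)) ∨
      (β l 1 = s (Fin.castAdd 2 l) ∧ β l 0 = t (Fin.castAdd 2 l) ∧
        t (Fin.castAdd 2 l) < s (Fin.castAdd 2 l)) := fun l => by
    rcases lt_or_gt_of_ne (hst (Fin.castAdd 2 l) (Fin.castAdd 2 l)) with h | h
    · exact Or.inl ⟨min_eq_left h.le, max_eq_right h.le, h⟩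
    · exact Or.inr ⟨max_eq_left h.le, min_eq_right h.le, h⟩
  have hslu : ∀ l : Fin m, s (Fin.castAdd 2 l) < s u := fun l => s.strictMono (hlu l)
  have htlu : ∀ l : Fin m, t (Fin.castAdd 2 l) < t u := fun l => t.strictMono (hlu l)
  refine ⟨α, β, γ, ⟨?_, α.strictMono, ?_, ?_, ?_, ?_, γ.strictMono⟩, ?_, hαi, ?_, hγ⟩
  · have hβmem : ∀ l e, β l e = s (Fin.castAdd 2 l) ∨ β l e = t (Fin.castAdd 2 l) := by
      intro l e
      fin_cases e
      · rcases hβ l with ⟨h, -⟩ | ⟨-, h, -⟩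
        exacts [Or.inl h, Or.inr h]
      · rcases hβ l with ⟨-, h, -⟩ | ⟨h, -⟩
        exacts [Or.inr h, Or.inl h]
    have hαβ : ∀ i l e, α i ≠ β l e := by
      intro i l e
      have h1 := hslu l
      have h2 := htlu l
      have h3 := h1.trans hsu
      have h4 := h2.trans htu
      rcases hα i with h | h | h | h <;> rcases hβmem l e with h' | h' <;> rw [h, h']
      exacts [h1.ne', hst _ _, h3.ne', hst _ _, (hst _ _).symm, h2.ne', (hst _ _).symm, h4.ne']
    refine α.injective.sumElim (Function.Injective.sumElim ?_ γ.injective ?_) ?_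
    · rintro ⟨l, e⟩ ⟨l', e'⟩ h
      have hll : l = l' := by
        simp only at h
        rcases hβmem l e with h1 | h1 <;> rcases hβmem l' e' with h2 | h2 <;>
          rw [h1, h2] at h
        · simpa using s.injective h
        · exact absurd h (hst _ _)
        · exact absurd h.symm (hst _ _)
        · simpa using t.injective h
      subst hll
      have hne : β l 0 ≠ β l 1 := by
        rcases hβ l with ⟨h, h', -⟩ | ⟨h, h', -⟩ <;> rw [h, h']
        exacts [hst _ _, (hst _ _).symm]
      fin_cases e <;> fin_cases e' <;> simp_all
    · rintro ⟨l, e⟩ b h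
      have h1 := Finset.mem_inter.1 (hγ b)
      simp only at h
      rw [← h] at h1
      rcases hβmem l e with h2 | h2 <;> rw [h2] at h1
      · exact (Finset.mem_sdiff.1 (hs _)).2 h1.2
      · exact (Finset.mem_sdiff.1 (ht _)).2 h1.1
    · rintro i (⟨l, e⟩ | b)
      · exact hαβ i l e
      · intro h
        have h1 := Finset.mem_inter.1 (hγ b)
        simp only [Sum.elim_inr] at h
        rw [← h] at h1
        rcases hαi i with h2 | h2
        · exact (Finset.mem_sdiff.1 h2).2 h1.2
        · exact (Finset.mem_sdiff.1 h2).2 h1.1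
  · intro l
    rcases hβ l with ⟨h, h', h''⟩ | ⟨h, h', h''⟩ <;> rw [h, h'] <;> exact h''
  · intro ν l l' hl
    have h1 : s (Fin.castAdd 2 l) < s (Fin.castAdd 2 l') := s.strictMono hl
    have h2 : t (Fin.castAdd 2 l) < t (Fin.castAdd 2 l') := t.strictMono hl
    fin_cases ν
    · exact min_lt_min h1 h2
    · exact max_lt_max h1 h2
  · intro l
    have h1 := hslu l
    have h2 := htlu l
    have h3 : β l 0 ≤ s (Fin.castAdd 2 l) := min_le_left _ _
    have h4 : β l 0 ≤ t (Fin.castAdd 2 l) := min_le_right _ _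
    rcases hα 0 with h | h | h | h <;> rw [h] <;> order
  · intro l
    by_contra hcon
    have h1 := hslu l
    have h2 := htlu l
    have h01 : α 0 < α 1 := α.strictMono (by decide)
    have h12 : α 1 < α 2 := α.strictMono (by decide)
    rw [not_lt] at hcon
    have hle : ∀ i, i ≤ 2 → α i ≤ β l 1 := fun i hi => (α.monotone hi).trans hcon
    have hdup : ∀ x y : Fin n, ¬ ∀ i : Fin 4, i ≤ 2 → α i = x ∨ α i = y := by
      intro x y h
      rcases h 0 (by decide) with e0 | e0 <;> rcases h 1 (by decide) with e1 | e1 <;>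
        rcases h 2 (by decide) with e2 | e2 <;> rw [e0, e1] at h01 <;> rw [e1, e2] at h12 <;>
        order
    rcases hβ l with ⟨-, hb, -⟩ | ⟨hb, -, -⟩ <;> rw [hb] at hle
    · refine hdup (s u) (s w) fun i hi => ?_
      have h := hle i hi
      rcases hα i with e | e | e | e
      · exact Or.inl e
      · exact Or.inr e
      · exact absurd (h.trans_lt h2) (by rw [e]; exact lt_irrefl _)
      · exact absurd (h.trans_lt (h2.trans htu)) (by rw [e]; exact lt_irrefl _)
    · refine hdup (t u) (t w) fun i hi => ?_
      have h := hle i hi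
      rcases hα i with e | e | e | e
      · exact absurd (h.trans_lt h1) (by rw [e]; exact lt_irrefl _)
      · exact absurd (h.trans_lt (h1.trans hsu)) (by rw [e]; exact lt_irrefl _)
      · exact Or.inl e
      · exact Or.inr e
  · have : (Finset.univ.filter fun i => α i ∈ S).image α = {s u, s w} := by
      ext x
      simp only [Finset.mem_image, Finset.mem_filter, Finset.mem_univ, true_and,
        Finset.mem_insert, Finset.mem_singleton]
      constructor
      · rintro ⟨i, hi, rfl⟩
        rcases hα i with h | h | h | h
        · exact Or.inl h
        · exact Or.inr h
        · rw [h] at hi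
          exact absurd hi (Finset.mem_sdiff.1 (ht _)).2
        · rw [h] at hi
          exact absurd hi (Finset.mem_sdiff.1 (ht _)).2
      · rintro (rfl | rfl)
        · obtain ⟨i, hi⟩ := hα' (s u) (by simp [A])
          exact ⟨i, by rw [hi]; exact (Finset.mem_sdiff.1 (hs _)).1, hi⟩
        · obtain ⟨i, hi⟩ := hα' (s w) (by simp [A])
          exact ⟨i, by rw [hi]; exact (Finset.mem_sdiff.1 (hs _)).1, hi⟩
    rw [← Finset.card_image_of_injective _ α.injective, this, Finset.card_pair hsu.ne]
  · intro l
    rcases hβ l with ⟨h, h', -⟩ | ⟨h, h', -⟩ <;> rw [h, h']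
    · exact Or.inl ⟨hs _, ht _⟩
    · exact Or.inr ⟨hs _, ht _⟩

variable {k} in
/-- If no index set strictly between `S` and `T` carries a nonzero coordinate, then `π_{ij}`
reduces to the coordinate at `S` when `α_i, α_j ∈ S`. -/
lemma piF_ne_zero {n m c : ℕ} {x : ExteriorAlgebra k (Fin n → k)} {S T : Finset (Fin n)}
    (hS : IsSupp (2 + (m + c)) x S) {α : Fin 4 → Fin n} {β : Fin m → Fin 2 → Fin n}
    {γ : Fin c → Fin n}
    (hinj : Function.Injective (Sum.elim α (Sum.elim (fun x : Fin m × Fin 2 => β x.1 x.2) γ)))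
    (hβ : ∀ l, (β l 0 ∈ S \ T ∧ β l 1 ∈ T \ S) ∨ (β l 1 ∈ S \ T ∧ β l 0 ∈ T \ S))
    (hγ : ∀ b, γ b ∈ S ∩ T) {i j : Fin 4} (hij : i ≠ j)
    (hi : α i ∈ S \ T) (hj : α j ∈ S \ T)
    (hW : ∀ ε, coordF k _ (tupleP m c α β γ i j ε) x ≠ 0 →
      Finset.univ.image (tupleP m c α β γ i j ε) = S ∨
        Finset.univ.image (tupleP m c α β γ i j ε) = T) :
    piF k m c α β γ i j x ≠ 0 := by
  have hε : ∀ l, ∃ e, β l e ∈ S \ T ∧ ∀ e', β l e' ∈ S → e' = e := by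
    intro l
    rcases hβ l with ⟨h, h'⟩ | ⟨h, h'⟩
    · refine ⟨0, h, fun e' he' => ?_⟩
      fin_cases e'
      · rfl
      · exact absurd he' (Finset.mem_sdiff.1 h').2
    · refine ⟨1, h, fun e' he' => ?_⟩
      fin_cases e'
      · exact absurd he' (Finset.mem_sdiff.1 h').2
      · rfl
  choose ε hε hε' using hε
  rw [piF, LinearMap.sum_apply, Finset.sum_eq_single ε]
  · have hinj' := tupleP_injective hinj hij ε
    refine hS.coordF_ne_zero hinj' (Finset.eq_of_subset_of_card_le ?_ ?_)
    · intro y hy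
      rcases mem_image_tupleP.1 hy with rfl | rfl | ⟨l, rfl⟩ | ⟨b, rfl⟩
      exacts [(Finset.mem_sdiff.1 hi).1, (Finset.mem_sdiff.1 hj).1,
        (Finset.mem_sdiff.1 (hε l)).1, (Finset.mem_inter.1 (hγ b)).1]
    · rw [Finset.card_image_of_injective _ hinj', hS.card_eq, Finset.card_fin]
  · intro ε' _ hne
    by_contra hcon
    rcases hW ε' hcon with h | h
    · apply hne
      funext l
      apply hε'
      rw [← h]
      exact mem_image_tupleP.2 (Or.inr (Or.inr (Or.inl ⟨l, rfl⟩)))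
    · apply (Finset.mem_sdiff.1 hi).2
      rw [← h]
      exact mem_image_tupleP.2 (Or.inl rfl)
  · simp

variable {k} in
lemma three_term_ne_zero {P : Fin 4 → Prop} [DecidablePred P]
    (hcard : (Finset.univ.filter P).card = 2) {a01 a02 a03 a12 a13 a23 : k}
    (k01 : a01 = 0 ↔ ¬(P 0 ↔ P 1)) (k02 : a02 = 0 ↔ ¬(P 0 ↔ P 2))
    (k03 : a03 = 0 ↔ ¬(P 0 ↔ P 3)) (k12 : a12 = 0 ↔ ¬(P 1 ↔ P 2))
    (k13 : a13 = 0 ↔ ¬(P 1 ↔ P 3)) (k23 : a23 = 0 ↔ ¬(P 2 ↔ P 3)) :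
    a01 * a23 - a02 * a13 + a03 * a12 ≠ 0 := by
  rw [Finset.card_filter, Fin.sum_univ_four] at hcard
  by_cases h0 : P 0 <;> by_cases h1 : P 1 <;> by_cases h2 : P 2 <;> by_cases h3 : P 3 <;>
    simp only [h0, h1, h2, h3, iff_self, iff_true, iff_false, not_true_eq_false,
      not_false_eq_true] at hcard k01 k02 k03 k12 k13 k23 <;>
    simp_all

variable {k} in
/-- If all ordered forms `P'` vanish, any two far apart index sets with nonzero coordinates have
a third one strictly between them. -/
lemma exists_isSupp_between {p n : ℕ} {x : ExteriorAlgebra k (Fin n → k)}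
    (hP : ∀ (m c : ℕ) (α : Fin 4 → Fin n) (β : Fin m → Fin 2 → Fin n) (γ : Fin c → Fin n),
      2 + (m + c) = p → OrderedABC m c α β γ → Pprime k m c α β γ x = 0)
    {S T : Finset (Fin n)} (hS : IsSupp p x S) (hT : IsSupp p x T) (h2 : 2 ≤ (T \ S).card) :
    ∃ W, IsSupp p x W ∧ S ∩ T ⊆ W ∧ W ⊆ S ∪ T ∧ W ≠ S ∧ W ≠ T := by
  by_contra! hcon
  obtain ⟨m, hm⟩ := Nat.exists_eq_add_of_le' h2
  obtain ⟨c, hc⟩ : ∃ c, (S ∩ T).card = c := ⟨_, rfl⟩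
  have h1 := Finset.card_sdiff_add_card_inter S T
  have h1' := Finset.card_sdiff_add_card_inter T S
  rw [hS.card_eq] at h1
  rw [hT.card_eq, Finset.inter_comm] at h1'
  have hp : 2 + (m + c) = p := by omega
  subst hp
  obtain ⟨α, β, γ, hO, hcard, hα, hβ, hγ⟩ :=
    exists_orderedABC (S := S) (T := T) (m := m) (c := c) (by omega) hm hc
  have hW : ∀ i j, i ≠ j → ∀ ε, coordF k _ (tupleP m c α β γ i j ε) x ≠ 0 →
      Finset.univ.image (tupleP m c α β γ i j ε) = S ∨
        Finset.univ.image (tupleP m c α β γ i j ε) = T := by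
    intro i j hij ε hne
    by_contra! hST
    refine hST.2 (hcon _ ⟨_, rfl, hne⟩ ?_ ?_ hST.1)
    · have hsub : Finset.univ.image γ ⊆ S ∩ T := by
        intro y hy
        obtain ⟨b, -, rfl⟩ := Finset.mem_image.1 hy
        exact hγ b
      have hγi : Function.Injective γ := hO.2.2.2.2.2.2.injective
      rw [← Finset.eq_of_subset_of_card_le hsub (by
        rw [Finset.card_image_of_injective _ hγi, hc, Finset.card_fin])]
      intro y hy
      obtain ⟨b, -, rfl⟩ := Finset.mem_image.1 hy
      exact mem_image_tupleP.2 (Or.inr (Or.inr (Or.inr ⟨b, rfl⟩)))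
    · intro y hy
      have hαu : ∀ i, α i ∈ S ∪ T := fun i => by
        have := hα i
        simp only [Finset.mem_sdiff, Finset.mem_union] at this ⊢
        tauto
      rcases mem_image_tupleP.1 hy with rfl | rfl | ⟨l, rfl⟩ | ⟨b, rfl⟩
      · exact hαu i
      · exact hαu j
      · have h := hβ l
        have he : ε l = 0 ∨ ε l = 1 := by omega
        simp only [Finset.mem_sdiff, Finset.mem_union] at h ⊢
        rcases he with he | he <;> rw [he] <;> tauto
      · have := hγ b
        simp only [Finset.mem_inter, Finset.mem_union] at this ⊢
        tauto
  have hne : ∀ i j, i ≠ j → (α i ∈ S ↔ α j ∈ S) → piF k m c α β γ i j x ≠ 0 := by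
    intro i j hij hiff
    have hi := hα i
    have hj := hα j
    rcases hi with hi | hi
    · have hj' : α j ∈ S \ T := by
        simp only [Finset.mem_sdiff] at hi hj ⊢
        tauto
      exact piF_ne_zero hS hO.1 hβ hγ hij hi hj' (hW i j hij)
    · have hj' : α j ∈ T \ S := by
        simp only [Finset.mem_sdiff] at hi hj ⊢
        tauto
      refine piF_ne_zero hT hO.1 (fun l => ?_) (fun b => ?_) hij hi hj'
        (fun ε h => (hW i j hij ε h).symm)
      · have := hβ l
        tauto
      · rw [Finset.inter_comm]
        exact hγ b
  have hzero : ∀ i j, i ≠ j → ¬(α i ∈ S ↔ α j ∈ S) → piF k m c α β γ i j x = 0 := by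
    intro i j hij hiff
    rw [piF, LinearMap.sum_apply]
    refine Finset.sum_eq_zero fun ε _ => ?_
    by_contra hcon'
    have hi : α i ∈ Finset.univ.image (tupleP m c α β γ i j ε) :=
      mem_image_tupleP.2 (Or.inl rfl)
    have hj : α j ∈ Finset.univ.image (tupleP m c α β γ i j ε) :=
      mem_image_tupleP.2 (Or.inr (Or.inl rfl))
    have hi' := hα i
    have hj' := hα j
    simp only [Finset.mem_sdiff] at hi' hj'
    rcases hW i j hij ε hcon' with h | h <;> rw [h] at hi hj <;> tauto
  have hP0 := hP m c α β γ rfl hO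
  rw [Pprime] at hP0
  have key : ∀ i j, i ≠ j → (piF k m c α β γ i j x = 0 ↔ ¬(α i ∈ S ↔ α j ∈ S)) :=
    fun i j hij => ⟨fun h h' => hne i j hij h' h, hzero i j hij⟩
  have k01 := key 0 1 (by decide)
  have k02 := key 0 2 (by decide)
  have k03 := key 0 3 (by decide)
  have k12 := key 1 2 (by decide)
  have k13 := key 1 3 (by decide)
  have k23 := key 2 3 (by decide)
  exact three_term_ne_zero (P := fun i => α i ∈ S) hcard k01 k02 k03 k12 k13 k23 hP0

variable {k} in
/-- Two index sets with nonzero coordinates are joined by an exchange step next to `T`. -/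
lemma exists_isSupp_adjacent {p n : ℕ} {x : ExteriorAlgebra k (Fin n → k)}
    (hP : ∀ (m c : ℕ) (α : Fin 4 → Fin n) (β : Fin m → Fin 2 → Fin n) (γ : Fin c → Fin n),
      2 + (m + c) = p → OrderedABC m c α β γ → Pprime k m c α β γ x = 0)
    {T : Finset (Fin n)} (hT : IsSupp p x T) :
    ∀ (d : ℕ) (S : Finset (Fin n)), IsSupp p x S → (T \ S).card = d + 1 →
      ∃ U, IsSupp p x U ∧ S ∩ T ⊆ U ∧ U ⊆ S ∪ T ∧ (T \ U).card = 1 := by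
  intro d
  induction d using Nat.strong_induction_on with
  | _ d ih =>
    intro S hS hd
    rcases Nat.eq_zero_or_pos d with rfl | hpos
    · exact ⟨S, hS, Finset.inter_subset_left, Finset.subset_union_left, hd⟩
    · obtain ⟨W, hW, h1, h2, hWS, hWT⟩ := exists_isSupp_between hP hS hT (by omega)
      have hsub : T \ W ⊆ T \ S := fun y hy => by
        rw [Finset.mem_sdiff] at hy ⊢
        exact ⟨hy.1, fun h => hy.2 (h1 (Finset.mem_inter.2 ⟨h, hy.1⟩))⟩
      have hlt : (T \ W).card < (T \ S).card := by
        refine lt_of_le_of_ne (Finset.card_le_card hsub) fun hcard => hWS ?_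
        have heq := Finset.eq_of_subset_of_card_le hsub hcard.ge
        refine Finset.eq_of_subset_of_card_le (fun y hy => ?_) (by rw [hS.card_eq, hW.card_eq])
        by_contra hyS
        have hyT : y ∈ T := (Finset.mem_union.1 (h2 hy)).resolve_left hyS
        have : y ∈ T \ W := heq ▸ Finset.mem_sdiff.2 ⟨hyT, hyS⟩
        exact (Finset.mem_sdiff.1 this).2 hy
      have hne : (T \ W).card ≠ 0 := fun h0 => hWT
        (Finset.eq_of_subset_of_card_le (Finset.sdiff_eq_empty_iff_subset.1
          (Finset.card_eq_zero.1 h0)) (by rw [hT.card_eq, hW.card_eq])).symm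
      obtain ⟨U, hU, h3, h4, h5⟩ := ih ((T \ W).card - 1) (by omega) W hW (by omega)
      refine ⟨U, hU, fun y hy => h3 ?_, fun y hy => ?_, h5⟩
      · exact Finset.mem_inter.2 ⟨h1 hy, (Finset.mem_inter.1 hy).2⟩
      · rcases Finset.mem_union.1 (h4 hy) with h | h
        · exact h2 h
        · exact Finset.mem_union_right _ h

lemma card_sdiff_of_between {A : Type*} [DecidableEq A] {S T U : Finset A} (h1 : S ∩ T ⊆ U)
    (h2 : U ⊆ S ∪ T) : (T \ S).card = (T \ U).card + (U \ S).card := by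
  rw [← Finset.card_union_of_disjoint]
  · congr 1
    ext y
    have h1 := @h1 y
    have h2 := @h2 y
    simp only [Finset.mem_inter, Finset.mem_union, Finset.mem_sdiff] at h1 h2 ⊢
    tauto
  · rw [Finset.disjoint_left]
    intro y hy hy'
    exact (Finset.mem_sdiff.1 hy).2 (Finset.mem_sdiff.1 hy').1

variable {k} in
/-- Two far apart index sets with nonzero coordinates are joined by two exchange steps
next to `T`. -/
lemma exists_isSupp_card_sdiff_eq_two {p n : ℕ} {x : ExteriorAlgebra k (Fin n → k)}
    (hP : ∀ (m c : ℕ) (α : Fin 4 → Fin n) (β : Fin m → Fin 2 → Fin n) (γ : Fin c → Fin n),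
      2 + (m + c) = p → OrderedABC m c α β γ → Pprime k m c α β γ x = 0)
    {S T : Finset (Fin n)} (hS : IsSupp p x S) (hT : IsSupp p x T) (h2 : 2 ≤ (T \ S).card) :
    ∃ U, IsSupp p x U ∧ S ∩ T ⊆ U ∧ U ⊆ S ∪ T ∧ (T \ U).card = 2 := by
  obtain ⟨V, hV, h3, h4, h5⟩ :=
    exists_isSupp_adjacent hP hT ((T \ S).card - 1) S hS (by omega)
  have h6 := card_sdiff_of_between h3 h4
  obtain ⟨U, hU, h7, h8, h9⟩ :=
    exists_isSupp_adjacent hP hV ((V \ S).card - 1) S hS (by omega)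
  have h10 := card_sdiff_of_between h7 h8
  have h11 : S ∩ T ⊆ U := fun y hy =>
    h7 (Finset.mem_inter.2 ⟨(Finset.mem_inter.1 hy).1, h3 hy⟩)
  have h12 : U ⊆ S ∪ T := fun y hy => by
    rcases Finset.mem_union.1 (h8 hy) with h | h
    · exact Finset.mem_union_left _ h
    · exact h4 h
  have h13 := card_sdiff_of_between h11 h12
  exact ⟨U, hU, h11, h12, by omega⟩

variable {k} in
lemma eq_of_three_term {P : Fin 4 → Prop} [DecidablePred P]
    (hcard : (Finset.univ.filter P).card = 2) {a b : Fin 4 → Fin 4 → k}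
    (hab : ∀ i j, i ≠ j → ¬(P i ∧ P j) → a i j = b i j)
    (hne : ∀ i j, i ≠ j → ¬P i → ¬P j → a i j ≠ 0)
    (ha : a 0 1 * a 2 3 - a 0 2 * a 1 3 + a 0 3 * a 1 2 = 0)
    (hb : b 0 1 * b 2 3 - b 0 2 * b 1 3 + b 0 3 * b 1 2 = 0) :
    ∃ i j, i ≠ j ∧ P i ∧ P j ∧ a i j = b i j := by
  rw [Finset.card_filter, Fin.sum_univ_four] at hcard
  have e01 := hab 0 1 (by decide)
  have e02 := hab 0 2 (by decide)
  have e03 := hab 0 3 (by decide)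
  have e12 := hab 1 2 (by decide)
  have e13 := hab 1 3 (by decide)
  have e23 := hab 2 3 (by decide)
  have n01 := hne 0 1 (by decide)
  have n02 := hne 0 2 (by decide)
  have n03 := hne 0 3 (by decide)
  have n12 := hne 1 2 (by decide)
  have n13 := hne 1 3 (by decide)
  have n23 := hne 2 3 (by decide)
  by_cases h0 : P 0 <;> by_cases h1 : P 1 <;> by_cases h2 : P 2 <;> by_cases h3 : P 3 <;>
    simp only [h0, h1, h2, h3, and_true, and_false, not_true_eq_false, not_false_eq_true,
      if_true, if_false, forall_const] at hcard e01 e02 e03 e12 e13 e23 <;> try omega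
  · exact ⟨0, 1, by decide, h0, h1, mul_right_cancel₀ (n23 h2 h3) (by
      rw [← e23, ← e02, ← e13, ← e03, ← e12] at hb
      linear_combination ha - hb)⟩
  · exact ⟨0, 2, by decide, h0, h2, mul_right_cancel₀ (n13 h1 h3) (by
      rw [← e23, ← e01, ← e13, ← e03, ← e12] at hb
      linear_combination hb - ha)⟩
  · exact ⟨0, 3, by decide, h0, h3, mul_right_cancel₀ (n12 h1 h2) (by
      rw [← e23, ← e01, ← e13, ← e02, ← e12] at hb
      linear_combination ha - hb)⟩
  · exact ⟨1, 2, by decide, h1, h2, mul_left_cancel₀ (n03 h0 h3) (by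
      rw [← e23, ← e01, ← e13, ← e02, ← e03] at hb
      linear_combination ha - hb)⟩
  · exact ⟨1, 3, by decide, h1, h3, mul_left_cancel₀ (n02 h0 h2) (by
      rw [← e23, ← e01, ← e12, ← e02, ← e03] at hb
      linear_combination hb - ha)⟩
  · exact ⟨2, 3, by decide, h2, h3, mul_left_cancel₀ (n01 h0 h1) (by
      rw [← e13, ← e01, ← e12, ← e02, ← e03] at hb
      linear_combination ha - hb)⟩

variable {k} in
/-- The three-term relations determine the coordinate at `idx` from the coordinates closer
to `S`. -/
lemma coordF_eq_of_closer {p n : ℕ} {x y : ExteriorAlgebra k (Fin n → k)}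
    (hPx : ∀ (m c : ℕ) (α : Fin 4 → Fin n) (β : Fin m → Fin 2 → Fin n) (γ : Fin c → Fin n),
      2 + (m + c) = p → OrderedABC m c α β γ → Pprime k m c α β γ x = 0)
    (hPy : ∀ (m c : ℕ) (α : Fin 4 → Fin n) (β : Fin m → Fin 2 → Fin n) (γ : Fin c → Fin n),
      2 + (m + c) = p → OrderedABC m c α β γ → Pprime k m c α β γ y = 0)
    {S U : Finset (Fin n)} {idx : Fin p → Fin n} (hidx : Function.Injective idx)
    (ih : ∀ idx' : Fin p → Fin n, Function.Injective idx' →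
      (Finset.univ.image idx' \ S).card < (Finset.univ.image idx \ S).card →
      coordF k p idx' x = coordF k p idx' y)
    (hU : IsSupp p x U) (h1 : S ∩ Finset.univ.image idx ⊆ U)
    (h2 : U ⊆ S ∪ Finset.univ.image idx) (h3 : (Finset.univ.image idx \ U).card = 2) :
    coordF k p idx x = coordF k p idx y := by
  obtain ⟨T, hT⟩ : ∃ T, Finset.univ.image idx = T := ⟨_, rfl⟩
  rw [hT] at ih h1 h2 h3
  have hTc : T.card = p := by rw [← hT, Finset.card_image_of_injective _ hidx, Finset.card_fin]
  have hTU := Finset.card_sdiff_add_card_inter T U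
  have hUT := Finset.card_sdiff_add_card_inter U T
  rw [hU.card_eq, Finset.inter_comm] at hUT
  obtain ⟨c, hc⟩ : ∃ c, (T ∩ U).card = c := ⟨_, rfl⟩
  have hp : 2 + (0 + c) = p := by omega
  subst hp
  obtain ⟨α, β, γ, hO, hcard, hα, -, hγ⟩ :=
    exists_orderedABC (S := T) (T := U) (m := 0) (c := c) (by omega) (by omega) hc
  let ε : Fin 0 → Fin 2 := Fin.elim0
  have hpi : ∀ i j z, piF k 0 c α β γ i j z = coordF k _ (tupleP 0 c α β γ i j ε) z := by
    intro i j z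
    rw [piF, Fintype.sum_subsingleton _ ε]
  have hinj : ∀ i j, i ≠ j → Function.Injective (tupleP 0 c α β γ i j ε) := fun i j hij =>
    tupleP_injective hO.1 hij ε
  have himage : ∀ i j (V : Finset (Fin n)), i ≠ j → V.card = 2 + (0 + c) → T ∩ U ⊆ V → α i ∈ V →
      α j ∈ V → Finset.univ.image (tupleP 0 c α β γ i j ε) = V := by
    intro i j V hij hV hsub hi hj
    refine Finset.eq_of_subset_of_card_le ?_ ?_
    · intro z hz
      rcases mem_image_tupleP.1 hz with rfl | rfl | ⟨l, -⟩ | ⟨b, rfl⟩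
      exacts [hi, hj, l.elim0, hsub (hγ b)]
    · rw [Finset.card_image_of_injective _ (hinj i j hij), hV, Finset.card_fin]
  have hαU : ∀ i, α i ∉ T → α i ∈ U := fun i hi => by
    have := hα i
    simp only [Finset.mem_sdiff] at this
    tauto
  have hclose : ∀ i j, i ≠ j → ¬(α i ∈ T ∧ α j ∈ T) →
      piF k 0 c α β γ i j x = piF k 0 c α β γ i j y := by
    intro i j hij hnot
    rw [hpi, hpi]
    apply ih _ (hinj i j hij)
    obtain ⟨a, b, ha, hb⟩ : ∃ a b, ({α i, α j} : Finset (Fin n)) = {a, b} ∧ a ∉ T := by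
      by_cases hi : α i ∈ T
      · exact ⟨α j, α i, Finset.pair_comm _ _, fun hj => hnot ⟨hi, hj⟩⟩
      · exact ⟨α i, α j, rfl, hi⟩
    have haS : a ∈ S := by
      have haU : a ∈ U := by
        have : a ∈ ({α i, α j} : Finset (Fin n)) := by rw [ha]; simp
        rcases Finset.mem_insert.1 this with rfl | h
        · exact hαU _ hb
        · rw [Finset.mem_singleton] at h
          subst h
          exact hαU _ hb
      exact (Finset.mem_union.1 (h2 haU)).resolve_right hb
    have hsub : Finset.univ.image (tupleP 0 c α β γ i j ε) \ S ⊆ insert b ((T ∩ U) \ S) := by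
      intro z hz
      rw [Finset.mem_sdiff] at hz
      rcases mem_image_tupleP.1 hz.1 with h | h | ⟨l, -⟩ | ⟨e, rfl⟩
      · have : z ∈ ({a, b} : Finset (Fin n)) := by rw [← ha, h]; simp
        rcases Finset.mem_insert.1 this with rfl | h'
        · exact absurd haS hz.2
        · exact Finset.mem_insert.2 (Or.inl (Finset.mem_singleton.1 h'))
      · have : z ∈ ({a, b} : Finset (Fin n)) := by rw [← ha, h]; simp
        rcases Finset.mem_insert.1 this with rfl | h'
        · exact absurd haS hz.2
        · exact Finset.mem_insert.2 (Or.inl (Finset.mem_singleton.1 h'))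
      · exact l.elim0
      · exact Finset.mem_insert_of_mem (Finset.mem_sdiff.2 ⟨hγ e, hz.2⟩)
    have hcl := (Finset.card_le_card hsub).trans (Finset.card_insert_le _ _)
    have hb1 := card_sdiff_of_between h1 h2
    have hb2 : (T ∩ U) \ S = U \ S := by
      ext z
      have := @h2 z
      simp only [Finset.mem_sdiff, Finset.mem_inter, Finset.mem_union] at this ⊢
      tauto
    rw [hb2] at hcl
    omega
  obtain ⟨i, j, hij, hi, hj, heq⟩ := eq_of_three_term (P := fun i => α i ∈ T) hcard
    (a := fun i j => piF k 0 c α β γ i j x) (b := fun i j => piF k 0 c α β γ i j y) hclose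
    (fun i j hij hi hj => by
      simp only [hpi]
      exact hU.coordF_ne_zero (hinj i j hij)
        (himage i j U hij hU.card_eq Finset.inter_subset_right (hαU i hi) (hαU j hj)))
    (hPx _ _ _ _ _ rfl hO) (hPy _ _ _ _ _ rfl hO)
  simp only [hpi] at heq
  exact (coordF_eq_iff_of_image_eq (hinj i j hij) hidx
    ((himage i j T hij hTc Finset.inter_subset_left hi hj).trans hT.symm) x y).1 heq

variable {k} in
/-- Two elements on which all ordered forms `P'` vanish agree as soon as their coordinates agree
near an index set `S` with a nonzero coordinate. -/
lemma coordF_eq_of_near {p n : ℕ} {x y : ExteriorAlgebra k (Fin n → k)}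
    (hPx : ∀ (m c : ℕ) (α : Fin 4 → Fin n) (β : Fin m → Fin 2 → Fin n) (γ : Fin c → Fin n),
      2 + (m + c) = p → OrderedABC m c α β γ → Pprime k m c α β γ x = 0)
    (hPy : ∀ (m c : ℕ) (α : Fin 4 → Fin n) (β : Fin m → Fin 2 → Fin n) (γ : Fin c → Fin n),
      2 + (m + c) = p → OrderedABC m c α β γ → Pprime k m c α β γ y = 0)
    {S : Finset (Fin n)} (hSx : IsSupp p x S) (hSy : IsSupp p y S)
    (hnear : ∀ idx : Fin p → Fin n, Function.Injective idx →
      (Finset.univ.image idx \ S).card < 2 → coordF k p idx x = coordF k p idx y) :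
    ∀ idx : Fin p → Fin n, Function.Injective idx → coordF k p idx x = coordF k p idx y := by
  intro idx hidx
  induction hd : (Finset.univ.image idx \ S).card using Nat.strong_induction_on
    generalizing idx with
  | _ d ih =>
    rcases Nat.lt_or_ge d 2 with h2 | h2
    · exact hnear idx hidx (hd ▸ h2)
    · have ih' : ∀ idx' : Fin p → Fin n, Function.Injective idx' →
          (Finset.univ.image idx' \ S).card < (Finset.univ.image idx \ S).card →
          coordF k p idx' x = coordF k p idx' y :=
        fun idx' h' hlt => ih _ (hd ▸ hlt) idx' h' rfl
      by_cases hx : coordF k p idx x = 0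
      · by_cases hy : coordF k p idx y = 0
        · rw [hx, hy]
        · obtain ⟨U, hU, h3, h4, h5⟩ :=
            exists_isSupp_card_sdiff_eq_two hPy hSy ⟨idx, rfl, hy⟩ (hd ▸ h2)
          exact (coordF_eq_of_closer hPy hPx hidx (fun i h h' => (ih' i h h').symm)
            hU h3 h4 h5).symm
      · obtain ⟨U, hU, h3, h4, h5⟩ :=
          exists_isSupp_card_sdiff_eq_two hPx hSx ⟨idx, rfl, hx⟩ (hd ▸ h2)
        exact coordF_eq_of_closer hPx hPy hidx ih' hU h3 h4 h5

variable {k} in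
/-- The decomposable element with prescribed coordinates at `idx₀` and next to it. -/
lemma exists_coordF_update_eq {p n : ℕ} (x : ExteriorAlgebra k (Fin n → k))
    (idx₀ : Fin p → Fin n) (h₀ : coordF k p idx₀ x ≠ 0) :
    ∃ v : Fin p → Fin n → k, ∀ i j,
      coordF k p (Function.update idx₀ i j) (coordF k p idx₀ x • ExteriorAlgebra.ιMulti k p v) =
        coordF k p (Function.update idx₀ i j) x := by
  refine ⟨fun i j => coordF k p (Function.update idx₀ i j) x / coordF k p idx₀ x,
    fun i j => ?_⟩
  rw [map_smul, coordF_ιMulti, ← Matrix.det_transpose]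
  have : Matrix.transpose (Matrix.of fun a b => coordF k p (Function.update idx₀ b
        (Function.update idx₀ i j a)) x / coordF k p idx₀ x) =
      (1 : Matrix (Fin p) (Fin p) k).updateCol i
        fun b => coordF k p (Function.update idx₀ b j) x / coordF k p idx₀ x := by
    ext b a
    rw [Matrix.transpose_apply, Matrix.of_apply, Matrix.updateCol_apply]
    split_ifs with h
    · subst h
      simp
    · rw [Function.update_of_ne h, Matrix.one_apply]
      split_ifs with hab
      · subst hab
        rw [Function.update_eq_self, div_self h₀]
      · have : coordF k p (Function.update idx₀ b (idx₀ a)) x = 0 := by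
          by_contra hne
          have := injective_of_coordF_ne_zero hne (a₁ := b) (a₂ := a)
            (by rw [Function.update_self, Function.update_of_ne (Ne.symm hab)])
          exact hab this
        rw [this, zero_div]
  rw [this, ← Matrix.cramer_apply, Matrix.cramer_one]
  simp [mul_div_cancel₀ _ h₀]

variable {k} in
lemma isDecomp_smul_ιMulti {p n : ℕ} (hp : 0 < p) (a : k) (v : Fin p → Fin n → k) :
    IsDecomp k p (a • ExteriorAlgebra.ιMulti k p v) := by
  refine ⟨Function.update v ⟨0, hp⟩ (a • v ⟨0, hp⟩), ?_⟩
  rw [AlternatingMap.map_update_smul, Function.update_eq_self]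

variable {k} in
lemma Pprime_eq_zero_of_isDecomp {p n : ℕ} {x : ExteriorAlgebra k (Fin n → k)}
    (hx : IsDecomp k p x) (m c : ℕ) (α : Fin 4 → Fin n) (β : Fin m → Fin 2 → Fin n)
    (γ : Fin c → Fin n) (hp : 2 + (m + c) = p) : Pprime k m c α β γ x = 0 := by
  subst hp
  obtain ⟨v, rfl⟩ := hx
  exact Pprime_ιMulti α β γ v

variable {k} in
lemma isDecomp_of_Pprime_eq_zero {p n : ℕ} (hp : 0 < p) (ω : ⋀[k]^p (Fin n → k))
    (hP : ∀ (m c : ℕ) (α : Fin 4 → Fin n) (β : Fin m → Fin 2 → Fin n) (γ : Fin c → Fin n),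
      2 + (m + c) = p → OrderedABC m c α β γ → Pprime k m c α β γ ω.val = 0) :
    IsDecomp k p ω.val := by
  by_cases hω : ∀ idx : Fin p → Fin n, coordF k p idx ω.val = 0
  · have : ω = 0 := eq_of_coordF_eq _ _ fun idx _ => by simp [hω idx]
    subst this
    simpa using isDecomp_smul_ιMulti hp (0 : k) (0 : Fin p → Fin n → k)
  · push Not at hω
    obtain ⟨idx₀, h₀⟩ := hω
    obtain ⟨v, hv⟩ := exists_coordF_update_eq ω.val idx₀ h₀
    have hinj₀ := injective_of_coordF_ne_zero h₀
    let y : ⋀[k]^p (Fin n → k) := coordF k p idx₀ ω.val • exteriorPower.ιMulti k p v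
    have hdec : IsDecomp k p y.val := isDecomp_smul_ιMulti hp _ v
    have hv₀ : coordF k p idx₀ y.val = coordF k p idx₀ ω.val := by
      have := hv ⟨0, hp⟩ (idx₀ ⟨0, hp⟩)
      rwa [Function.update_eq_self] at this
    have hωy : ω = y := by
      refine eq_of_coordF_eq _ _ (coordF_eq_of_near hP
        (fun m c α β γ h _ => Pprime_eq_zero_of_isDecomp hdec m c α β γ h)
        (S := Finset.univ.image idx₀) ⟨idx₀, rfl, h₀⟩ ⟨idx₀, rfl, hv₀.symm ▸ h₀⟩ ?_)
      intro idx hidx hlt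
      have hcard : (Finset.univ.image idx).card = (Finset.univ.image idx₀).card := by
        rw [Finset.card_image_of_injective _ hidx, Finset.card_image_of_injective _ hinj₀]
      have hsd := Finset.card_sdiff_add_card_inter (Finset.univ.image idx)
        (Finset.univ.image idx₀)
      have hsd' := Finset.card_sdiff_add_card_inter (Finset.univ.image idx₀)
        (Finset.univ.image idx)
      rw [Finset.inter_comm] at hsd'
      interval_cases hc : (Finset.univ.image idx \ Finset.univ.image idx₀).card
      · have him : Finset.univ.image idx = Finset.univ.image idx₀ :=
          Finset.eq_of_subset_of_card_le
            (Finset.sdiff_eq_empty_iff_subset.1 (Finset.card_eq_zero.1 hc)) hcard.ge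
        exact (coordF_eq_iff_of_image_eq hidx hinj₀ him _ _).2 hv₀.symm
      · obtain ⟨j, hj⟩ := Finset.card_eq_one.1 hc
        obtain ⟨z, hz⟩ := Finset.card_eq_one.1
          (show (Finset.univ.image idx₀ \ Finset.univ.image idx).card = 1 by omega)
        have hjmem : j ∈ Finset.univ.image idx \ Finset.univ.image idx₀ := by simp [hj]
        have hzmem : z ∈ Finset.univ.image idx₀ \ Finset.univ.image idx := by simp [hz]
        rw [Finset.mem_sdiff] at hjmem hzmem
        obtain ⟨i, -, rfl⟩ := Finset.mem_image.1 hzmem.1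
        have hj₀ : ∀ a, idx₀ a ≠ j := fun a ha =>
          hjmem.2 (Finset.mem_image.2 ⟨a, Finset.mem_univ _, ha⟩)
        have hinj : Function.Injective (Function.update idx₀ i j) := by
          intro a b hab
          rw [Function.update_apply, Function.update_apply] at hab
          split_ifs at hab with ha hb hb
          · rw [ha, hb]
          · exact absurd hab.symm (hj₀ b)
          · exact absurd hab (hj₀ a)
          · exact hinj₀ hab
        have him : Finset.univ.image (Function.update idx₀ i j) = Finset.univ.image idx := by
          refine Finset.eq_of_subset_of_card_le ?_ ?_
          · intro w hw
            obtain ⟨a, -, rfl⟩ := Finset.mem_image.1 hw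
            rw [Function.update_apply]
            split_ifs with ha
            · exact hjmem.1
            · by_contra hcon
              have : idx₀ a ∈ Finset.univ.image idx₀ \ Finset.univ.image idx :=
                Finset.mem_sdiff.2 ⟨Finset.mem_image_of_mem _ (Finset.mem_univ _), hcon⟩
              rw [hz, Finset.mem_singleton] at this
              exact ha (hinj₀ this)
          · rw [Finset.card_image_of_injective _ hidx, Finset.card_image_of_injective _ hinj]
        exact (coordF_eq_iff_of_image_eq hinj hidx him _ _).1 (hv i j).symm
    rw [hωy]
    exact hdec

/-- For `2 ≤ p ≤ n-2`, an element `ω ∈ ⋀^p k^n` is decomposable if and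
only if `P'_{A,B,C}(ω) = 0` for every triple `(A,B,C)` satisfying the distinctness and
ordering conditions. -/
theorem grassmann_decomposable_iff_Pprime_vanish
    {k : Type*} [Field k] {p n : ℕ} (hp : 2 ≤ p) (hpn : p ≤ n - 2)
    (ω : ⋀[k]^p (Fin n → k)) :
    IsDecomp k p ω.val ↔
      ∀ (m c : ℕ) (α : Fin 4 → Fin n) (β : Fin m → Fin 2 → Fin n) (γ : Fin c → Fin n),
        2 + (m + c) = p → OrderedABC m c α β γ →
          Pprime k m c α β γ ω.val = 0 := by
  exact ⟨fun h m c α β γ hpc _ => Pprime_eq_zero_of_isDecomp h m c α β γ hpc,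
    isDecomp_of_Pprime_eq_zero (by omega) ω⟩

end
end

section
/- Let p, n be natural numbers with 2 ≤ p ≤ n−2. An element ω ∈ ⋀^p k^n is indecomposable if and only if there exists a triple (A,B,C) whose indices α_i, β_j^(μ), γ_l are all distinct and satisfy α_i < α_{i+1}, β_i^0 < β_i^1, β_i^ν < β_{i+1}^ν, β_i^0 < α_1, β_i^1 < α_3, γ_i < γ_{i+1}, such that G_{A,B,C}(ω) ∈ ⋀^2 k^4 is indecomposable. -/
open ExteriorAlgebra

noncomputable section

variable (k : Type*) [Field k]

namespace GrassmannCone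

open Matrix Finset

section Coordinates

variable {K : Type*} [Field K] {n q : ℕ}

theorem coordF_ιMulti (idx : Fin q → Fin n) (v : Fin q → Fin n → K) :
    coordF K q idx (ιMulti K q v) = det (of fun a b => v a (idx b)) := by
  rw [coordF, liftAlternating_apply_ιMulti, Function.update_self]
  rfl

theorem eq_of_eq_on_ιMulti {V N : Type*} [AddCommGroup V] [Module K V] [AddCommGroup N]
    [Module K N] {F G : ExteriorAlgebra K V →ₗ[K] N}
    (h : ∀ v, F (ιMulti K q v) = G (ιMulti K q v)) {ω : ExteriorAlgebra K V}
    (hω : ω ∈ ⋀[K]^q V) : F ω = G ω := by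
  rw [← ιMulti_span_fixedDegree] at hω
  refine LinearMap.eqOn_span (f := F) (g := G) ?_ hω
  rintro _ ⟨v, rfl⟩
  exact h v

theorem coordF_comp_perm (idx : Fin q → Fin n) (σ : Equiv.Perm (Fin q))
    {ω : ExteriorAlgebra K (Fin n → K)} (hω : ω ∈ ⋀[K]^q (Fin n → K)) :
    coordF K q (idx ∘ σ) ω = ((Equiv.Perm.sign σ : ℤ) : K) * coordF K q idx ω := by
  refine eq_of_eq_on_ιMulti (F := coordF K q (idx ∘ σ))
    (G := ((Equiv.Perm.sign σ : ℤ) : K) • coordF K q idx) (fun v => ?_) hω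
  rw [LinearMap.smul_apply, coordF_ιMulti, coordF_ιMulti, smul_eq_mul, ← det_permute']
  rfl

theorem coordF_eq_zero_of_not_injective {idx : Fin q → Fin n} (h : ¬ Function.Injective idx)
    {ω : ExteriorAlgebra K (Fin n → K)} (hω : ω ∈ ⋀[K]^q (Fin n → K)) :
    coordF K q idx ω = 0 := by
  refine eq_of_eq_on_ιMulti (G := 0) (fun v => ?_) hω
  obtain ⟨i, j, hij, hne⟩ : ∃ i j, idx i = idx j ∧ i ≠ j := by
    simpa [Function.Injective] using h
  rw [coordF_ιMulti]
  exact det_zero_of_column_eq hne fun a => by simp [hij]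

theorem eq_of_coordF_eq {ω ω' : ExteriorAlgebra K (Fin n → K)}
    (hω : ω ∈ ⋀[K]^q (Fin n → K)) (hω' : ω' ∈ ⋀[K]^q (Fin n → K))
    (h : ∀ idx, coordF K q idx ω = coordF K q idx ω') : ω = ω' := by
  let b := (Pi.basisFun K (Fin n)).exteriorPower q
  have key : ∀ (η : ⋀[K]^q (Fin n → K)) s,
      b.repr η s = coordF K q (Set.powersetCard.ofFinEmbEquiv.symm s) η.1 := by
    intro η s
    rw [exteriorPower.basis_repr_apply]
    have : exteriorPower.ιMultiDual K q (Pi.basisFun K (Fin n)) s =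
        (coordF K q (Set.powersetCard.ofFinEmbEquiv.symm s)).comp (Submodule.subtype _) := by
      apply exteriorPower.linearMap_ext
      ext v
      simp only [LinearMap.compAlternatingMap_apply, exteriorPower.ιMultiDual_apply_ιMulti,
        LinearMap.comp_apply, Submodule.subtype_apply, exteriorPower.ιMulti_apply_coe,
        coordF_ιMulti]
      simp
    rw [this]
    rfl
  have : (⟨ω, hω⟩ : ⋀[K]^q (Fin n → K)) = ⟨ω', hω'⟩ := by
    apply b.ext_elem
    intro s
    rw [key, key]
    exact h _
  exact congrArg Subtype.val this

theorem exists_perm_of_image_eq {f g : Fin q → Fin n} (hf : Function.Injective f)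
    (hg : Function.Injective g) (h : univ.image f = univ.image g) :
    ∃ σ : Equiv.Perm (Fin q), f = g ∘ σ := by
  have h' : Set.range f = Set.range g := by
    have := congrArg (fun s : Finset (Fin n) => (s : Set (Fin n))) h
    simpa using this
  refine ⟨(Equiv.ofInjective f hf).trans
    ((Equiv.setCongr h').trans (Equiv.ofInjective g hg).symm), funext fun x => ?_⟩
  simp [Equiv.apply_ofInjective_symm]

/-- Tuples with the same set of entries define the same coordinate up to a common sign. -/
theorem exists_sign_coordF {f g : Fin q → Fin n} (hf : Function.Injective f)
    (h : univ.image f = univ.image g) :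
    ∃ s : K, s ≠ 0 ∧ ∀ ω ∈ ⋀[K]^q (Fin n → K), coordF K q f ω = s * coordF K q g ω := by
  have hg : Function.Injective g := by
    have : (univ.image g).card = (univ : Finset (Fin q)).card := by
      rw [← h, card_image_of_injective _ hf]
    simpa [Set.injOn_univ] using card_image_iff.1 this
  obtain ⟨σ, rfl⟩ := exists_perm_of_image_eq hf hg h
  refine ⟨((Equiv.Perm.sign σ : ℤ) : K), ?_, fun ω hω => coordF_comp_perm g σ hω⟩
  rcases Int.units_eq_one_or (Equiv.Perm.sign σ) with h | h <;> simp [h]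

end Coordinates

section PlueckerRelation

variable {K : Type*} [Field K]

/-- The three-term Plücker relation for maximal minors with all but two rows in common. -/
theorem det_three_term {q : ℕ} (a b c d : Fin (q + 2) → K) (R : Fin q → Fin (q + 2) → K) :
    det (of (vecCons a (vecCons b R))) * det (of (vecCons c (vecCons d R))) -
      det (of (vecCons a (vecCons c R))) * det (of (vecCons b (vecCons d R))) +
      det (of (vecCons a (vecCons d R))) * det (of (vecCons b (vecCons c R))) = 0 := by
  let f : (Fin (q + 2) → K) →ₗ[K] K :=
    (detRowAlternating (R := K) (n := Fin (q + 2))).toMultilinearMap.toLinearMap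
      (vecCons a (vecCons 0 R)) 1
  have hf : ∀ w, f w = det (of (vecCons a (vecCons w R))) := by
    intro w
    change detRowAlternating (Function.update (vecCons a (vecCons 0 R)) 1 w) = _
    congr 1
    ext i
    refine Fin.cases ?_ (fun i => ?_) i
    · simp [vecCons]
    · refine Fin.cases ?_ (fun i => ?_) i
      · simp [vecCons]
      · rw [Function.update_of_ne (by simp [Fin.ext_iff])]
        simp [vecCons]
  have hfR : ∀ i, f (R i) = 0 := by
    intro i
    rw [hf]
    refine det_zero_of_row_eq (i := 1) (j := i.succ.succ) (by simp [Fin.ext_iff]) ?_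
    simp [vecCons]
    rfl
  let w : Fin (q + 3) → Fin (q + 2) → K := vecCons b (vecCons c (vecCons d R))
  let M : Matrix (Fin (q + 3)) (Fin (q + 3)) K := of fun i => vecCons (f (w i)) (w i)
  have hM : det M = 0 := by
    refine exists_mulVec_eq_zero_iff.1
      ⟨vecCons (-1) fun j => f (Pi.single j 1), fun h => ?_, ?_⟩
    · simpa using congrFun h 0
    · ext i
      have hs : ∀ j : Fin (q + 2), (Pi.single j 1 : Fin (q + 2) → K) =
          fun l => if j = l then 1 else 0 := fun j => by
        ext l; simp [Pi.single_apply, eq_comm]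
      have := LinearMap.pi_apply_eq_sum_univ f (w i)
      simp only [M, mulVec, of_apply, dotProduct, Fin.sum_univ_succ (n := q + 2), cons_val_zero,
        cons_val_succ, Pi.zero_apply]
      rw [this]
      simp [hs]
  rw [det_succ_column_zero, Fin.sum_univ_succ, Fin.sum_univ_succ, Fin.sum_univ_succ] at hM
  rw [Finset.sum_eq_zero (s := univ) (f := fun i : Fin q => _) (fun i _ => by
    simp [M, w, hfR])] at hM
  have h0 : M.submatrix (Fin.succAbove 0) Fin.succ = of (vecCons c (vecCons d R)) := by
    ext i j; rfl
  have h1 : M.submatrix (Fin.succAbove (Fin.succ 0)) Fin.succ = of (vecCons b (vecCons d R)) := by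
    ext i j
    refine Fin.cases ?_ (fun i => ?_) i
    · rfl
    · simp [M, w]
  have h2 : M.submatrix (Fin.succAbove (Fin.succ (Fin.succ 0))) Fin.succ =
      of (vecCons b (vecCons c R)) := by
    ext i j
    refine Fin.cases ?_ (fun i => Fin.cases ?_ (fun i => ?_) i) i
    · rfl
    · simp only [submatrix_apply, Fin.succ_succAbove_succ]
      simp [M, w]
    · simp only [submatrix_apply, Fin.succ_succAbove_succ]
      simp [M, w]
  rw [h0, h1, h2] at hM
  simp only [M, w, of_apply, cons_val_zero, cons_val_succ, hf, Fin.val_succ, Fin.val_zero] at hM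
  norm_num at hM
  linear_combination hM

theorem det_append_pair {r : ℕ} (a b : Fin (2 + r) → K) (R : Fin r → Fin (2 + r) → K) :
    det (of (Fin.append ![a, b] R)) =
      det (of (vecCons (a ∘ finCongr (Nat.add_comm r 2))
        (vecCons (b ∘ finCongr (Nat.add_comm r 2)) fun i => R i ∘ finCongr (Nat.add_comm r 2)))) := by
  rw [← det_submatrix_equiv_self (finCongr (Nat.add_comm r 2)) (of (Fin.append ![a, b] R))]
  congr 1
  ext i j
  refine Fin.cases ?_ (fun i => Fin.cases ?_ (fun i => ?_) i) i
  · have : finCongr (Nat.add_comm r 2) 0 = Fin.castAdd r (0 : Fin 2) := by ext; simp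
    simp only [submatrix_apply, this, of_apply, Fin.append_left]
    rfl
  · have : finCongr (Nat.add_comm r 2) (Fin.succ 0) = Fin.castAdd r (1 : Fin 2) := by ext; simp
    simp only [submatrix_apply, this, of_apply, Fin.append_left]
    rfl
  · have : finCongr (Nat.add_comm r 2) i.succ.succ = Fin.natAdd 2 i := by ext; simp; omega
    simp only [submatrix_apply, this, of_apply, Fin.append_right]
    rfl

theorem det_append_three_term {r : ℕ} (a : Fin 4 → Fin (2 + r) → K)
    (R : Fin r → Fin (2 + r) → K) :
    det (of (Fin.append ![a 0, a 1] R)) * det (of (Fin.append ![a 2, a 3] R)) -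
      det (of (Fin.append ![a 0, a 2] R)) * det (of (Fin.append ![a 1, a 3] R)) +
      det (of (Fin.append ![a 0, a 3] R)) * det (of (Fin.append ![a 1, a 2] R)) = 0 := by
  simp only [det_append_pair]
  exact det_three_term _ _ _ _ _

theorem map_append_append_sum {V : Type*} [AddCommGroup V] [Module K V] {s m c : ℕ}
    (f : MultilinearMap K (fun _ : Fin (s + (m + c)) => V) K)
    (x : Fin s → V) (y : Fin m → Fin 2 → V) (z : Fin c → V) :
    f (Fin.append x (Fin.append (fun l => ∑ e, y l e) z)) =
      ∑ ε : Fin m → Fin 2, f (Fin.append x (Fin.append (fun l => y l (ε l)) z)) := by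
  let A := (f.domDomCongr finSumFinEquiv.symm).currySum x
  let B := (A.domDomCongr finSumFinEquiv.symm).currySum
  have hB : ∀ u, B u z = f (Fin.append x (Fin.append u z)) := by
    intro u
    change f _ = f _
    congr 1
    ext i
    refine Fin.addCases (fun i => ?_) (fun i => ?_) i
    · simp
    · simp only [Fin.append_right, finSumFinEquiv_symm_apply_natAdd]
      refine Fin.addCases (fun i => ?_) (fun i => ?_) i <;> simp
  rw [← hB, MultilinearMap.map_sum, _root_.sum_apply]
  exact Finset.sum_congr rfl fun ε _ => hB _

theorem piF_ιMulti {n m c : ℕ} (α : Fin 4 → Fin n) (β : Fin m → Fin 2 → Fin n)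
    (γ : Fin c → Fin n) (i j : Fin 4) (v : Fin (2 + (m + c)) → Fin n → K) :
    piF K m c α β γ i j (ιMulti K _ v) =
      det (of (Fin.append ![fun a => v a (α i), fun a => v a (α j)]
        (Fin.append (fun l => ∑ e, fun a => v a (β l e)) fun l a => v a (γ l)))) := by
  rw [piF, LinearMap.sum_apply]
  refine Eq.trans (Finset.sum_congr rfl fun ε _ => ?_)
    (map_append_append_sum (detRowAlternating (R := K)).toMultilinearMap _
      (fun l e a => v a (β l e)) _).symm
  rw [coordF_ιMulti, ← det_transpose]
  change det _ = det _
  congr 1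
  ext b a
  simp only [transpose_apply, of_apply, tupleP]
  refine Fin.addCases (fun b => ?_) (fun b => ?_) b
  · fin_cases b <;> simp
  · simp only [Fin.append_right]
    refine Fin.addCases (fun b => ?_) (fun b => ?_) b <;> simp

theorem Pprime_ιMulti {n m c : ℕ} (α : Fin 4 → Fin n) (β : Fin m → Fin 2 → Fin n)
    (γ : Fin c → Fin n) (v : Fin (2 + (m + c)) → Fin n → K) :
    Pprime K m c α β γ (ιMulti K _ v) = 0 := by
  simp only [Pprime, piF_ιMulti]
  exact det_append_three_term (fun i a => v a (α i)) _

end PlueckerRelation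

section Pairing

variable {n m c : ℕ}

theorem OrderedABC.injective_tupleP {α : Fin 4 → Fin n} {β : Fin m → Fin 2 → Fin n}
    {γ : Fin c → Fin n}
    (h : Function.Injective (Sum.elim α (Sum.elim (fun x : Fin m × Fin 2 => β x.1 x.2) γ)))
    {i j : Fin 4} (hij : i ≠ j) (ε : Fin m → Fin 2) :
    Function.Injective (tupleP m c α β γ i j ε) := by
  let g : Fin (2 + (m + c)) → Fin 4 ⊕ (Fin m × Fin 2) ⊕ Fin c :=
    Fin.append ![.inl i, .inl j]
      (Fin.append (fun l => .inr (.inl (l, ε l))) fun s => .inr (.inr s))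
  have hg : Function.Injective g := by
    intro x y
    refine Fin.addCases (fun x => ?_) (fun x => ?_) x <;>
      refine Fin.addCases (fun y => ?_) (fun y => ?_) y
    · fin_cases x <;> fin_cases y <;> simp [g, hij, hij.symm]
    · refine Fin.addCases (fun y => ?_) (fun y => ?_) y <;> fin_cases x <;> simp [g]
    · refine Fin.addCases (fun x => ?_) (fun x => ?_) x <;> fin_cases y <;> simp [g]
    · refine Fin.addCases (fun x => ?_) (fun x => ?_) x <;>
        refine Fin.addCases (fun y => ?_) (fun y => ?_) y <;>
        simp +contextual [g]
  convert h.comp hg using 1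
  ext1 x
  refine Fin.addCases (fun x => ?_) (fun x => ?_) x
  · fin_cases x <;> simp [g, tupleP]
  · refine Fin.addCases (fun x => ?_) (fun x => ?_) x <;> simp [g, tupleP]

theorem mem_image_tupleP {α : Fin 4 → Fin n} {β : Fin m → Fin 2 → Fin n} {γ : Fin c → Fin n}
    {i j : Fin 4} {ε : Fin m → Fin 2} {x : Fin n} :
    x ∈ univ.image (tupleP m c α β γ i j ε) ↔
      x = α i ∨ x = α j ∨ (∃ l, x = β l (ε l)) ∨ ∃ s, x = γ s := by
  simp only [mem_image, mem_univ, true_and, tupleP]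
  constructor
  · rintro ⟨t, rfl⟩
    refine Fin.addCases (fun t => ?_) (fun t => ?_) t
    · fin_cases t <;> simp
    · refine Fin.addCases (fun t => ?_) (fun t => ?_) t
      · exact .inr (.inr (.inl ⟨t, by simp⟩))
      · simp
  · rintro (rfl | rfl | ⟨l, rfl⟩ | ⟨s, rfl⟩)
    · exact ⟨Fin.castAdd _ 0, by simp⟩
    · exact ⟨Fin.castAdd _ 1, by simp⟩
    · exact ⟨Fin.natAdd _ (Fin.castAdd _ l), by simp⟩
    · exact ⟨Fin.natAdd _ (Fin.natAdd _ s), by simp⟩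

/-- Pairing off two disjoint increasing sequences entry by entry gives a triple `(A, B, C)`,
where `A` consists of the last two pairs. -/
theorem exists_orderedABC_of_strictMono {a b : Fin (m + 2) → Fin n} {γ : Fin c → Fin n}
    (ha : StrictMono a) (hb : StrictMono b) (hγ : StrictMono γ) (hab : ∀ s t, a s ≠ b t)
    (haγ : ∀ s t, a s ≠ γ t) (hbγ : ∀ s t, b s ≠ γ t) :
    ∃ (α : Fin 4 → Fin n) (β : Fin m → Fin 2 → Fin n) (i j k l : Fin 4) (ε : Fin m → Fin 2),
      OrderedABC m c α β γ ∧ i < j ∧ k < l ∧ i ≠ k ∧ i ≠ l ∧ j ≠ k ∧ j ≠ l ∧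
      (∀ x ∈ ({i, j} : Finset (Fin 4)), ∃ s, α x = a s) ∧
      (∀ x ∈ ({k, l} : Finset (Fin 4)), ∃ s, α x = b s) ∧
      (∀ t, ∃ s, β t (ε t) = a s) ∧ ∀ t, ∀ e ≠ ε t, ∃ s, β t e = b s := by
  let u₀ : Fin (m + 2) := Fin.natAdd m 0
  let u₁ : Fin (m + 2) := Fin.natAdd m 1
  have hu : u₀ < u₁ := by simp [u₀, u₁, Fin.lt_def]
  have hu₀ : ∀ t : Fin m, Fin.castAdd 2 t < u₀ := fun t => by simp [u₀, Fin.lt_def]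
  let A : Finset (Fin n) := {a u₀, a u₁, b u₀, b u₁}
  have hA : A.card = 4 := by
    have h1 := ha.injective.ne hu.ne
    have h2 := hb.injective.ne hu.ne
    simp only [A]
    rw [card_insert_of_notMem, card_insert_of_notMem, card_insert_of_notMem, card_singleton] <;>
      simp [h1, h2, hab]
  let α := A.orderEmbOfFin hA
  have hα : StrictMono α := α.strictMono
  have hmem : ∀ x, α x = a u₀ ∨ α x = a u₁ ∨ α x = b u₀ ∨ α x = b u₁ := fun x => by
    have h : α x ∈ A := A.orderEmbOfFin_mem hA x
    simpa only [A, mem_insert, mem_singleton] using h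
  have hsurj : ∀ y ∈ A, ∃ x, α x = y := fun y hy => by
    have : y ∈ Set.range α := by rw [A.range_orderEmbOfFin hA]; exact hy
    exact this
  obtain ⟨i, hi⟩ := hsurj (a u₀) (by simp [A])
  obtain ⟨j, hj⟩ := hsurj (a u₁) (by simp [A])
  obtain ⟨k, hk⟩ := hsurj (b u₀) (by simp [A])
  obtain ⟨l, hl⟩ := hsurj (b u₁) (by simp [A])
  have hij : i < j := hα.lt_iff_lt.1 (by rw [hi, hj]; exact ha hu)
  have hkl : k < l := hα.lt_iff_lt.1 (by rw [hk, hl]; exact hb hu)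
  let ε : Fin m → Fin 2 := fun t => if a (Fin.castAdd 2 t) < b (Fin.castAdd 2 t) then 0 else 1
  let β : Fin m → Fin 2 → Fin n := fun t e =>
    if e = ε t then a (Fin.castAdd 2 t) else b (Fin.castAdd 2 t)
  have hβ : ∀ t e, (e = ε t ∧ β t e = a (Fin.castAdd 2 t)) ∨
      (e ≠ ε t ∧ β t e = b (Fin.castAdd 2 t)) := fun t e => by
    by_cases h : e = ε t <;> simp [β, h]
  have hβ₀ : ∀ t, β t 0 = min (a (Fin.castAdd 2 t)) (b (Fin.castAdd 2 t)) := fun t => by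
    by_cases h : a (Fin.castAdd 2 t) < b (Fin.castAdd 2 t)
    · simp [β, ε, h, min_eq_left h.le]
    · simp [β, ε, h, min_eq_right (not_lt.1 h)]
  have hβ₁ : ∀ t, β t 1 = max (a (Fin.castAdd 2 t)) (b (Fin.castAdd 2 t)) := fun t => by
    by_cases h : a (Fin.castAdd 2 t) < b (Fin.castAdd 2 t)
    · simp [β, ε, h, max_eq_right h.le]
    · simp [β, ε, h, max_eq_left (not_lt.1 h)]
  have hαβ : ∀ x t e, α x ≠ β t e := by
    intro x t e
    have h0 := (hu₀ t).ne'
    have h1 := ((hu₀ t).trans hu).ne'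
    rcases hmem x with h | h | h | h <;> rcases hβ t e with ⟨-, h'⟩ | ⟨-, h'⟩ <;> rw [h, h']
    all_goals first
      | exact hab _ _
      | exact (hab _ _).symm
      | exact ha.injective.ne h0
      | exact ha.injective.ne h1
      | exact hb.injective.ne h0
      | exact hb.injective.ne h1
  have hαγ : ∀ x s, α x ≠ γ s := by
    intro x s
    rcases hmem x with h | h | h | h <;> rw [h] <;> first | exact haγ _ _ | exact hbγ _ _
  have hβγ : ∀ t e s, β t e ≠ γ s := by
    intro t e s
    rcases hβ t e with ⟨-, h⟩ | ⟨-, h⟩ <;> rw [h] <;> first | exact haγ _ _ | exact hbγ _ _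
  have hββ : ∀ t e t' e', β t e = β t' e' → t = t' ∧ e = e' := by
    intro t e t' e' h
    rcases hβ t e with ⟨h1, h2⟩ | ⟨h1, h2⟩ <;> rcases hβ t' e' with ⟨h3, h4⟩ | ⟨h3, h4⟩ <;>
      rw [h2, h4] at h
    · obtain rfl := Fin.castAdd_injective _ _ (ha.injective h)
      exact ⟨rfl, h1.trans h3.symm⟩
    · exact absurd h (hab _ _)
    · exact absurd h.symm (hab _ _)
    · obtain rfl := Fin.castAdd_injective _ _ (hb.injective h)
      exact ⟨rfl, by omega⟩
  refine ⟨α, β, i, j, k, l, ε, ⟨?_, hα, fun t => ?_, fun ν => ?_, fun t => ?_, fun t => ?_, hγ⟩,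
    hij, hkl, ?_, ?_, ?_, ?_, ?_, ?_, fun t => ⟨Fin.castAdd 2 t, by simp [β]⟩,
    fun t e he => ⟨Fin.castAdd 2 t, by simp [β, he]⟩⟩
  · rintro (x | ⟨t, e⟩ | s) (x' | ⟨t', e'⟩ | s') h <;>
      simp only [Sum.elim_inl, Sum.elim_inr] at h
    · rw [hα.injective h]
    · exact absurd h (hαβ _ _ _)
    · exact absurd h (hαγ _ _)
    · exact absurd h.symm (hαβ _ _ _)
    · obtain ⟨rfl, rfl⟩ := hββ _ _ _ _ h
      rfl
    · exact absurd h (hβγ _ _ _)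
    · exact absurd h.symm (hαγ _ _)
    · exact absurd h.symm (hβγ _ _ _)
    · rw [hγ.injective h]
  · rw [hβ₀, hβ₁]
    exact min_lt_max.2 (hab _ _)
  · intro t t' htt
    have h1 : a (Fin.castAdd 2 t) < a (Fin.castAdd 2 t') := ha htt
    have h2 : b (Fin.castAdd 2 t) < b (Fin.castAdd 2 t') := hb htt
    fin_cases ν
    · change β t 0 < β t' 0
      rw [hβ₀, hβ₀]
      exact min_lt_min h1 h2
    · change β t 1 < β t' 1
      rw [hβ₁, hβ₁]
      exact max_lt_max h1 h2
  · rw [hβ₀]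
    have h1 := ha (hu₀ t)
    have h2 := hb (hu₀ t)
    rcases hmem 0 with h | h | h | h <;> rw [h]
    · exact min_lt_of_left_lt h1
    · exact min_lt_of_left_lt (h1.trans (ha hu))
    · exact min_lt_of_right_lt h2
    · exact min_lt_of_right_lt (h2.trans (hb hu))
  · rw [hβ₁]
    have h1 : a u₀ ≤ α 2 := hi ▸ hα.monotone (by omega)
    have h2 : b u₀ ≤ α 2 := hk ▸ hα.monotone (by omega)
    exact max_lt ((ha (hu₀ t)).trans_le h1) ((hb (hu₀ t)).trans_le h2)
  · rintro rfl; exact hab _ _ (hi.symm.trans hk)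
  · rintro rfl; exact hab _ _ (hi.symm.trans hl)
  · rintro rfl; exact hab _ _ (hj.symm.trans hk)
  · rintro rfl; exact hab _ _ (hj.symm.trans hl)
  · simpa using ⟨⟨u₀, hi⟩, ⟨u₁, hj⟩⟩
  · simpa using ⟨⟨u₀, hk⟩, ⟨u₁, hl⟩⟩

theorem exists_orderedABC {I J : Finset (Fin n)} (hI : (I \ J).card = m + 2)
    (hJ : (J \ I).card = m + 2) (hIJ : (I ∩ J).card = c) :
    ∃ (α : Fin 4 → Fin n) (β : Fin m → Fin 2 → Fin n) (γ : Fin c → Fin n) (i j k l : Fin 4)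
      (ε : Fin m → Fin 2),
      OrderedABC m c α β γ ∧ i < j ∧ k < l ∧ i ≠ k ∧ i ≠ l ∧ j ≠ k ∧ j ≠ l ∧
      (∀ x ∈ ({i, j} : Finset (Fin 4)), α x ∈ I \ J) ∧
      (∀ x ∈ ({k, l} : Finset (Fin 4)), α x ∈ J \ I) ∧
      (∀ t, β t (ε t) ∈ I \ J) ∧ (∀ t, ∀ e ≠ ε t, β t e ∈ J \ I) ∧
      univ.image γ = I ∩ J := by
  have ha := (I \ J).orderEmbOfFin_mem hI
  have hb := (J \ I).orderEmbOfFin_mem hJ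
  have hc := (I ∩ J).orderEmbOfFin_mem hIJ
  obtain ⟨α, β, i, j, k, l, ε, h, hij, hkl, h1, h2, h3, h4, h5, h6, h7, h8⟩ :=
    exists_orderedABC_of_strictMono (a := (I \ J).orderEmbOfFin hI)
      (b := (J \ I).orderEmbOfFin hJ) (γ := (I ∩ J).orderEmbOfFin hIJ)
      (OrderEmbedding.strictMono _) (OrderEmbedding.strictMono _) (OrderEmbedding.strictMono _)
      (fun s t e => by have h1 := ha s; have h2 := hb t; rw [e] at h1; grind)
      (fun s t e => by have h1 := ha s; have h2 := hc t; rw [e] at h1; grind)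
      (fun s t e => by have h1 := hb s; have h2 := hc t; rw [e] at h1; grind)
  refine ⟨α, β, _, i, j, k, l, ε, h, hij, hkl, h1, h2, h3, h4, fun x hx => ?_, fun x hx => ?_,
    fun t => ?_, fun t e he => ?_, by simp⟩
  · obtain ⟨s, hs⟩ := h5 x hx
    exact hs ▸ ha s
  · obtain ⟨s, hs⟩ := h6 x hx
    exact hs ▸ hb s
  · obtain ⟨s, hs⟩ := h7 t
    exact hs ▸ ha s
  · obtain ⟨s, hs⟩ := h8 t e he
    exact hs ▸ hb s

end Pairing

section Reconstruction

variable {K : Type*} [Field K] {n : ℕ}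

theorem mul_sub_eq_zero_of_three_term {φ ψ : Fin 4 → Fin 4 → K}
    (hφ : φ 0 1 * φ 2 3 - φ 0 2 * φ 1 3 + φ 0 3 * φ 1 2 = 0)
    (hψ : ψ 0 1 * ψ 2 3 - ψ 0 2 * ψ 1 3 + ψ 0 3 * ψ 1 2 = 0) {i j k l : Fin 4}
    (hij : i < j) (hkl : k < l) (hik : i ≠ k) (hil : i ≠ l) (hjk : j ≠ k) (hjl : j ≠ l)
    (h : ∀ x y, x < y → ¬ (x = k ∧ y = l) → φ x y = ψ x y) :
    φ i j * (φ k l - ψ k l) = 0 := by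
  have hcases : (i = 0 ∧ j = 1) ∨ (i = 2 ∧ j = 3) ∨ (i = 0 ∧ j = 2) ∨ (i = 1 ∧ j = 3) ∨
      (i = 0 ∧ j = 3) ∨ (i = 1 ∧ j = 2) := by omega
  have h01 := h 0 1 (by decide)
  have h02 := h 0 2 (by decide)
  have h03 := h 0 3 (by decide)
  have h12 := h 1 2 (by decide)
  have h13 := h 1 3 (by decide)
  have h23 := h 2 3 (by decide)
  clear h
  rcases hcases with ⟨rfl, rfl⟩ | ⟨rfl, rfl⟩ | ⟨rfl, rfl⟩ | ⟨rfl, rfl⟩ | ⟨rfl, rfl⟩ | ⟨rfl, rfl⟩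
  · obtain ⟨rfl, rfl⟩ : k = 2 ∧ l = 3 := by omega
    simp at h01 h02 h03 h12 h13 h23
    grind
  · obtain ⟨rfl, rfl⟩ : k = 0 ∧ l = 1 := by omega
    simp at h01 h02 h03 h12 h13 h23
    grind
  · obtain ⟨rfl, rfl⟩ : k = 1 ∧ l = 3 := by omega
    simp at h01 h02 h03 h12 h13 h23
    grind
  · obtain ⟨rfl, rfl⟩ : k = 0 ∧ l = 2 := by omega
    simp at h01 h02 h03 h12 h13 h23
    grind
  · obtain ⟨rfl, rfl⟩ : k = 1 ∧ l = 2 := by omega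
    simp at h01 h02 h03 h12 h13 h23
    grind
  · obtain ⟨rfl, rfl⟩ : k = 0 ∧ l = 3 := by omega
    simp at h01 h02 h03 h12 h13 h23
    grind

/-- If two elements on which the forms `P'` vanish have equal coordinates at all sets between
`I ∩ J` and `I ∪ J` other than `J`, and those coordinates vanish at the sets strictly closer
to `J` than `I` but still differing in two elements, then the `I`-coordinate vanishes or the
`J`-coordinates agree. -/
theorem exists_coordF_mul_sub_eq_zero {m c : ℕ} {ω ω' : ExteriorAlgebra K (Fin n → K)}
    (hP : ∀ (α : Fin 4 → Fin n) (β : Fin m → Fin 2 → Fin n) (γ : Fin c → Fin n),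
      OrderedABC m c α β γ → Pprime K m c α β γ ω = 0)
    (hP' : ∀ (α : Fin 4 → Fin n) (β : Fin m → Fin 2 → Fin n) (γ : Fin c → Fin n),
      OrderedABC m c α β γ → Pprime K m c α β γ ω' = 0)
    {I J : Finset (Fin n)} (hI : (I \ J).card = m + 2) (hJ : (J \ I).card = m + 2)
    (hIJ : (I ∩ J).card = c)
    (hne : ∀ f : Fin (2 + (m + c)) → Fin n, Function.Injective f → univ.image f ⊆ I ∪ J →
      I ∩ J ⊆ univ.image f → univ.image f ≠ J → coordF K _ f ω = coordF K _ f ω')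
    (hlt : ∀ f : Fin (2 + (m + c)) → Fin n, Function.Injective f → univ.image f ⊆ I ∪ J →
      I ∩ J ⊆ univ.image f → 2 ≤ (univ.image f \ J).card →
      (univ.image f \ J).card < (I \ J).card → coordF K _ f ω = 0) :
    ∃ f g : Fin (2 + (m + c)) → Fin n, Function.Injective f ∧ Function.Injective g ∧
      univ.image f = I ∧ univ.image g = J ∧
      coordF K _ f ω * (coordF K _ g ω - coordF K _ g ω') = 0 := by
  obtain ⟨α, β, γ, i, j, k, l, ε, hABC, hij, hkl, hik, hil, hjk, hjl, h5, h6, h7, h8, h9⟩ :=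
    exists_orderedABC hI hJ hIJ
  have hinj := hABC.1
  have hγ : ∀ s, γ s ∈ I ∩ J := fun s => h9 ▸ mem_image_of_mem γ (mem_univ s)
  have hα : ∀ x, x = i ∨ x = j ∨ x = k ∨ x = l := by omega
  let ε' : Fin m → Fin 2 := fun t => 1 - ε t
  have hε' : ∀ t, ε' t ≠ ε t := fun t => by simp only [ε']; omega
  have hεε' : ∀ t e, e ≠ ε t → e = ε' t := fun t e => by simp only [ε']; omega
  have hsub : ∀ x y η, univ.image (tupleP m c α β γ x y η) ⊆ I ∪ J := by
    have hα' : ∀ x, α x ∈ I ∪ J := fun x => by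
      have := h5 x
      have := h6 x
      have := hα x
      grind
    intro x y η z hz
    rw [mem_image_tupleP] at hz
    rcases hz with rfl | rfl | ⟨t, rfl⟩ | ⟨s, rfl⟩
    · exact hα' _
    · exact hα' _
    · by_cases ht : η t = ε t
      · rw [ht]
        exact mem_union_left _ (mem_sdiff.1 (h7 t)).1
      · exact mem_union_right _ (mem_sdiff.1 (h8 t _ ht)).1
    · exact mem_union_left _ (mem_inter.1 (hγ s)).1
  have hsup : ∀ x y η, I ∩ J ⊆ univ.image (tupleP m c α β γ x y η) := by
    intro x y η z hz
    rw [← h9] at hz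
    rw [mem_image_tupleP]
    obtain ⟨s, -, rfl⟩ := mem_image.1 hz
    exact .inr (.inr (.inr ⟨s, rfl⟩))
  have hJeq : ∀ x y η, x < y → univ.image (tupleP m c α β γ x y η) = J →
      (x = k ∧ y = l) ∧ η = ε' := by
    intro x y η hxy h
    have hmem : ∀ z, (z = α x ∨ z = α y ∨ (∃ t, z = β t (η t)) ∨ ∃ s, z = γ s) → z ∈ J :=
      fun z hz => h ▸ mem_image_tupleP.2 hz
    have hx := hmem _ (.inl rfl)
    have hy := hmem _ (.inr (.inl rfl))
    have hx' := h5 x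
    have hy' := h5 y
    refine ⟨?_, funext fun t => hεε' t _ fun ht => ?_⟩
    · have := hα x
      have := hα y
      simp only [mem_insert, mem_singleton, mem_sdiff] at hx' hy'
      have : x ≠ i := by grind
      have : x ≠ j := by grind
      have : y ≠ i := by grind
      have : y ≠ j := by grind
      omega
    · have h2 := hmem _ (.inr (.inr (.inl ⟨t, rfl⟩)))
      rw [ht] at h2
      exact (mem_sdiff.1 (h7 t)).2 h2
  have hf := OrderedABC.injective_tupleP hinj hij.ne ε
  have hg := OrderedABC.injective_tupleP hinj hkl.ne ε'
  have hcardI : I.card = 2 + (m + c) := by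
    rw [← card_sdiff_add_card_inter I J, hI, hIJ]; omega
  have hcardJ : J.card = 2 + (m + c) := by
    rw [← card_sdiff_add_card_inter J I, hJ, inter_comm, hIJ]; omega
  refine ⟨tupleP m c α β γ i j ε, tupleP m c α β γ k l ε', hf, hg, ?_, ?_, ?_⟩
  · refine eq_of_subset_of_card_le (fun z hz => ?_) ?_
    · rw [mem_image_tupleP] at hz
      rcases hz with rfl | rfl | ⟨t, rfl⟩ | ⟨s, rfl⟩
      · exact (mem_sdiff.1 (h5 i (by simp))).1
      · exact (mem_sdiff.1 (h5 j (by simp))).1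
      · exact (mem_sdiff.1 (h7 t)).1
      · exact (mem_inter.1 (hγ s)).1
    · rw [card_image_of_injective _ hf, hcardI, card_univ, Fintype.card_fin]
  · refine eq_of_subset_of_card_le (fun z hz => ?_) ?_
    · rw [mem_image_tupleP] at hz
      rcases hz with rfl | rfl | ⟨t, rfl⟩ | ⟨s, rfl⟩
      · exact (mem_sdiff.1 (h6 k (by simp))).1
      · exact (mem_sdiff.1 (h6 l (by simp))).1
      · exact (mem_sdiff.1 (h8 t _ (hε' t))).1
      · exact (mem_inter.1 (hγ s)).2
    · rw [card_image_of_injective _ hg, hcardJ, card_univ, Fintype.card_fin]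
  · have hpi : ∀ x y, x < y → ¬ (x = k ∧ y = l) →
        piF K m c α β γ x y ω = piF K m c α β γ x y ω' := by
      intro x y hxy hne'
      rw [piF, LinearMap.sum_apply, LinearMap.sum_apply]
      exact sum_congr rfl fun η _ => hne _ (OrderedABC.injective_tupleP hinj hxy.ne η)
        (hsub _ _ _) (hsup _ _ _) fun h => hne' (hJeq x y η hxy h).1
    have key := mul_sub_eq_zero_of_three_term (φ := fun x y => piF K m c α β γ x y ω)
      (ψ := fun x y => piF K m c α β γ x y ω') (hP α β γ hABC) (hP' α β γ hABC)
      hij hkl hik hil hjk hjl hpi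
    have hkl' : piF K m c α β γ k l ω - piF K m c α β γ k l ω' =
        coordF K _ (tupleP m c α β γ k l ε') ω - coordF K _ (tupleP m c α β γ k l ε') ω' := by
      rw [piF, LinearMap.sum_apply, LinearMap.sum_apply, ← sum_sub_distrib]
      refine sum_eq_single ε' (fun η _ hη => sub_eq_zero.2 ?_) (by simp)
      exact hne _ (OrderedABC.injective_tupleP hinj hkl.ne η) (hsub _ _ _) (hsup _ _ _)
        fun h => hη (hJeq k l η hkl h).2
    have hij' : piF K m c α β γ i j ω = coordF K _ (tupleP m c α β γ i j ε) ω := by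
      rw [piF, LinearMap.sum_apply]
      refine sum_eq_single ε (fun η _ hη => ?_) (by simp)
      refine hlt _ (OrderedABC.injective_tupleP hinj hij.ne η) (hsub _ _ _) (hsup _ _ _) ?_ ?_
      · refine (card_pair (show α i ≠ α j from hABC.2.1.injective.ne hij.ne)).symm.le.trans
          (card_le_card fun z hz => mem_sdiff.2 ⟨mem_image_tupleP.2 ?_, ?_⟩)
        · simp only [mem_insert, mem_singleton] at hz
          tauto
        · rw [mem_insert, mem_singleton] at hz
          rcases hz with rfl | rfl
          · exact (mem_sdiff.1 (h5 i (by simp))).2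
          · exact (mem_sdiff.1 (h5 j (by simp))).2
      · obtain ⟨t, ht⟩ := Function.ne_iff.1 hη
        refine card_lt_card (ssubset_iff_of_subset ?_ |>.2 ⟨β t (ε t), h7 t, ?_⟩)
        · exact fun z hz => mem_sdiff.2 ⟨(mem_union.1 (hsub i j η (mem_sdiff.1 hz).1)).resolve_right
            (mem_sdiff.1 hz).2, (mem_sdiff.1 hz).2⟩
        · rw [mem_sdiff, mem_image_tupleP]
          rintro ⟨h | h | ⟨t', h⟩ | ⟨s, h⟩, -⟩
          · simpa using @hinj (.inr (.inl (t, ε t))) (.inl i) h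
          · simpa using @hinj (.inr (.inl (t, ε t))) (.inl j) h
          · have := @hinj (.inr (.inl (t, ε t))) (.inr (.inl (t', η t'))) h
            simp only [Sum.inr.injEq, Sum.inl.injEq, Prod.mk.injEq] at this
            obtain ⟨rfl, h⟩ := this
            exact ht h.symm
          · simpa using @hinj (.inr (.inl (t, ε t))) (.inr (.inr s)) h
    simpa only [hkl', hij'] using key

theorem Pprime_eq_zero_of_isDecomp {p m c : ℕ} (h : 2 + (m + c) = p) (α : Fin 4 → Fin n)
    (β : Fin m → Fin 2 → Fin n) (γ : Fin c → Fin n) {ω : ExteriorAlgebra K (Fin n → K)}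
    (hω : IsDecomp K p ω) : Pprime K m c α β γ ω = 0 := by
  subst h
  obtain ⟨v, rfl⟩ := hω
  exact Pprime_ιMulti α β γ v

theorem card_image_sdiff_comm {p : ℕ} {f g : Fin p → Fin n} (hf : Function.Injective f)
    (hg : Function.Injective g) :
    (univ.image f \ univ.image g).card = (univ.image g \ univ.image f).card := by
  have h1 := card_sdiff_add_card_inter (univ.image f) (univ.image g)
  have h2 := card_sdiff_add_card_inter (univ.image g) (univ.image f)
  rw [card_image_of_injective _ hf] at h1
  rw [card_image_of_injective _ hg, inter_comm] at h2
  omega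

theorem coordF_eq_zero_of_two_le_card_sdiff {p : ℕ} {ω ω' : ExteriorAlgebra K (Fin n → K)}
    (hω : ω ∈ ⋀[K]^p (Fin n → K)) (hω' : ω' ∈ ⋀[K]^p (Fin n → K))
    (hP : ∀ (m c : ℕ) (α : Fin 4 → Fin n) (β : Fin m → Fin 2 → Fin n) (γ : Fin c → Fin n),
      2 + (m + c) = p → OrderedABC m c α β γ → Pprime K m c α β γ ω = 0)
    (hP' : ∀ (m c : ℕ) (α : Fin 4 → Fin n) (β : Fin m → Fin 2 → Fin n) (γ : Fin c → Fin n),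
      2 + (m + c) = p → OrderedABC m c α β γ → Pprime K m c α β γ ω' = 0)
    {U D : Finset (Fin n)} {g : Fin p → Fin n} (hg : Function.Injective g)
    (hgU : univ.image g ⊆ U) (hDg : D ⊆ univ.image g) (hgω : coordF K p g ω ≠ coordF K p g ω')
    (hne : ∀ f : Fin p → Fin n, Function.Injective f → univ.image f ⊆ U → D ⊆ univ.image f →
      univ.image f ≠ univ.image g → coordF K p f ω = coordF K p f ω')
    (f : Fin p → Fin n) (hf : Function.Injective f) (hfU : univ.image f ⊆ U)
    (hDf : D ⊆ univ.image f) (h2 : 2 ≤ (univ.image f \ univ.image g).card) :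
    coordF K p f ω = 0 := by
  induction hN : (univ.image f \ univ.image g).card using Nat.strong_induction_on
    generalizing f with
  | _ N ih =>
  subst hN
  obtain ⟨m, hm⟩ := Nat.exists_eq_add_of_le' h2
  obtain ⟨c, hc⟩ : ∃ c, (univ.image f ∩ univ.image g).card = c := ⟨_, rfl⟩
  have hp : 2 + (m + c) = p := by
    have := card_sdiff_add_card_inter (univ.image f) (univ.image g)
    rw [card_image_of_injective _ hf, card_univ, Fintype.card_fin] at this
    omega
  have hU : univ.image f ∪ univ.image g ⊆ U := union_subset hfU hgU
  have hD : D ⊆ univ.image f ∩ univ.image g := subset_inter hDf hDg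
  subst hp
  obtain ⟨f', g', hf', hg', hff', hgg', h⟩ := exists_coordF_mul_sub_eq_zero
    (fun α β γ => hP m c α β γ rfl) (fun α β γ => hP' m c α β γ rfl) hm
    (card_image_sdiff_comm hf hg ▸ hm) hc
    (fun e he h1 h2 => hne e he (h1.trans hU) (hD.trans h2))
    (fun e he h1 h2 h3 h4 => ih _ h4 e he (h1.trans hU) (hD.trans h2) h3 rfl)
  obtain ⟨s, hs, hsf⟩ := exists_sign_coordF (K := K) hf hff'.symm
  obtain ⟨t, -, htg⟩ := exists_sign_coordF (K := K) hg hgg'.symm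
  rcases mul_eq_zero.1 h with h | h
  · rw [hsf ω hω, h, mul_zero]
  · refine absurd ?_ hgω
    rw [htg ω hω, htg ω' hω', sub_eq_zero.1 h]

theorem exists_image_update_eq {p : ℕ} (hp : 0 < p) {f g : Fin p → Fin n}
    (hf : Function.Injective f) (hg : Function.Injective g)
    (h : (univ.image f \ univ.image g).card ≤ 1) :
    ∃ a j, univ.image f = univ.image (Function.update g a j) := by
  have hle : ∀ e : Fin p → Fin n, univ.image f ⊆ univ.image e → univ.image f = univ.image e := by
    intro e he
    refine eq_of_subset_of_card_le he ?_
    rw [card_image_of_injective _ hf]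
    exact card_image_le
  rcases Nat.le_one_iff_eq_zero_or_eq_one.1 h with h0 | h1
  · refine ⟨⟨0, hp⟩, g ⟨0, hp⟩, ?_⟩
    rw [Function.update_eq_self]
    exact hle _ (sdiff_eq_empty_iff_subset.1 (card_eq_zero.1 h0))
  · obtain ⟨j, hj⟩ := card_eq_one.1 h1
    obtain ⟨y, hy⟩ := card_eq_one.1 (card_image_sdiff_comm hf hg ▸ h1)
    have hy' : y ∈ univ.image g \ univ.image f := by rw [hy]; simp
    obtain ⟨hyg, hyf⟩ := mem_sdiff.1 hy'
    obtain ⟨a, -, rfl⟩ := mem_image.1 hyg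
    refine ⟨a, j, hle _ fun z hz => ?_⟩
    by_cases hzg : z ∈ univ.image g
    · obtain ⟨b, -, rfl⟩ := mem_image.1 hzg
      have hba : b ≠ a := by rintro rfl; exact hyf hz
      exact mem_image.2 ⟨b, mem_univ _, by simp [hba]⟩
    · have : z ∈ univ.image f \ univ.image g := mem_sdiff.2 ⟨hz, hzg⟩
      rw [hj, mem_singleton] at this
      exact mem_image.2 ⟨a, mem_univ _, by simp [this]⟩

/-- For any nonzero coordinate of `ω` there is a decomposable element with the same coordinates
as `ω` at the tuples obtained by changing at most one index. -/
theorem exists_ιMulti_coordF_update_eq {p : ℕ} (hp : 0 < p) {ω : ExteriorAlgebra K (Fin n → K)}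
    (hω : ω ∈ ⋀[K]^p (Fin n → K)) {g : Fin p → Fin n} (hg : coordF K p g ω ≠ 0) :
    ∃ v : Fin p → Fin n → K, ∀ a j,
      coordF K p (Function.update g a j) (ιMulti K p v) =
        coordF K p (Function.update g a j) ω := by
  let v : Fin p → Fin n → K := fun r j => (coordF K p g ω)⁻¹ * coordF K p (Function.update g r j) ω
  have hv : ∀ r b, v r (g b) = (1 : Matrix (Fin p) (Fin p) K) r b := by
    intro r b
    by_cases h : r = b
    · subst h
      simp [v, hg]
    · have : coordF K p (Function.update g r (g b)) ω = 0 :=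
        coordF_eq_zero_of_not_injective
          (fun hi => h (hi (by simp [Function.update_of_ne (Ne.symm h)]))) hω
      simp [v, this, h]
  refine ⟨Function.update v ⟨0, hp⟩ (coordF K p g ω • v ⟨0, hp⟩), fun a j => ?_⟩
  rw [AlternatingMap.map_update_smul, Function.update_eq_self, map_smul, coordF_ιMulti]
  have : (of fun r b => v r (Function.update g a j b)) =
      updateCol (1 : Matrix (Fin p) (Fin p) K) a fun r => v r j := by
    ext r b
    by_cases h : b = a
    · subst h
      simp
    · simp [h, hv]
  rw [this, ← cramer_apply, cramer_one]
  simp [v, hg]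

theorem isDecomp_of_Pprime_eq_zero {p : ℕ} (hp : 2 ≤ p) {ω : ExteriorAlgebra K (Fin n → K)}
    (hω : ω ∈ ⋀[K]^p (Fin n → K))
    (hP : ∀ (m c : ℕ) (α : Fin 4 → Fin n) (β : Fin m → Fin 2 → Fin n) (γ : Fin c → Fin n),
      2 + (m + c) = p → OrderedABC m c α β γ → Pprime K m c α β γ ω = 0) :
    IsDecomp K p ω := by
  by_cases h0 : ∀ g, coordF K p g ω = 0
  · refine ⟨0, eq_of_coordF_eq hω (ιMulti_range K p ⟨0, rfl⟩) fun g => ?_⟩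
    have : ιMulti K p (0 : Fin p → Fin n → K) = 0 :=
      (ιMulti K p).map_coord_zero ⟨0, by omega⟩ rfl
    rw [h0, this, map_zero]
  push Not at h0
  obtain ⟨g, hg0⟩ := h0
  have hg : Function.Injective g := by
    by_contra h
    exact hg0 (coordF_eq_zero_of_not_injective h hω)
  obtain ⟨v, hv⟩ := exists_ιMulti_coordF_update_eq (by omega) hω hg0
  have hω' : ιMulti K p v ∈ ⋀[K]^p (Fin n → K) := ιMulti_range K p ⟨v, rfl⟩
  refine ⟨v, eq_of_coordF_eq hω hω' fun f => ?_⟩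
  induction hN : (univ.image f \ univ.image g).card using Nat.strong_induction_on
    generalizing f with
  | _ N ih =>
  subst hN
  by_cases hf : Function.Injective f
  swap
  · rw [coordF_eq_zero_of_not_injective hf hω, coordF_eq_zero_of_not_injective hf hω']
  rcases Nat.lt_or_ge 1 (univ.image f \ univ.image g).card with h2 | h1
  swap
  · obtain ⟨a, j, haj⟩ := exists_image_update_eq (by omega) hf hg h1
    obtain ⟨s, -, hs⟩ := exists_sign_coordF (K := K) hf haj
    rw [hs ω hω, hs _ hω', hv]
  by_contra hne
  refine hg0 (coordF_eq_zero_of_two_le_card_sdiff hω hω' hP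
    (fun m c α β γ h _ => Pprime_eq_zero_of_isDecomp h α β γ ⟨v, rfl⟩) hf
    (U := univ.image g ∪ univ.image f) (D := univ.image g ∩ univ.image f) subset_union_right
    inter_subset_right hne (fun e he heU hDe hef => ?_) g hg subset_union_left inter_subset_left
    (card_image_sdiff_comm hf hg ▸ h2))
  refine ih _ (card_lt_card ⟨fun z hz => ?_, fun hsub => hef ?_⟩) e rfl
  · have := heU (mem_sdiff.1 hz).1
    grind
  · refine (eq_of_subset_of_card_le (fun z hz => ?_) ?_).symm
    · by_cases hzg : z ∈ univ.image g
      · exact hDe (mem_inter.2 ⟨hzg, hz⟩)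
      · exact (mem_sdiff.1 (hsub (mem_sdiff.2 ⟨hz, hzg⟩))).1
    · rw [card_image_of_injective _ he, card_image_of_injective _ hf]

end Reconstruction

section Inversions

variable {K : Type*} [Field K] {q r n : ℕ}

/-- The sign `(-1) ^ i`, where `i` is the number of pairs not strictly increasing under `f`. -/
def inversionSign (f : Fin q → Fin n) : ℤ :=
  ∏ i, ∏ j, if i < j ∧ ¬ f i < f j then -1 else 1

theorem inversionSign_mul_self (f : Fin q → Fin n) :
    inversionSign f * inversionSign f = 1 := by
  simp only [inversionSign, ← prod_mul_distrib]
  exact prod_eq_one fun i _ => prod_eq_one fun j _ => by split_ifs <;> rfl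

theorem inversionSign_perm (σ : Equiv.Perm (Fin q)) :
    inversionSign σ = Equiv.Perm.sign σ := by
  rw [Equiv.Perm.sign_eq_prod_prod_Ioi, inversionSign, Units.coe_prod]
  refine prod_congr rfl fun i _ => ?_
  rw [Units.coe_prod, ← filter_lt_eq_Ioi, prod_filter]
  refine prod_congr rfl fun j _ => ?_
  split_ifs <;> simp_all

theorem inversionSign_comp {g : Fin r → Fin n} (hg : StrictMono g) (f : Fin q → Fin r) :
    inversionSign (g ∘ f) = inversionSign f := by
  simp only [inversionSign, Function.comp_apply, hg.lt_iff_lt]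

theorem inversionSign_append_pair {a b : Fin n} (hab : a < b) (R : Fin r → Fin n) :
    inversionSign (Fin.append ![a, b] R) =
      (∏ t, if a < R t then 1 else -1) * (∏ t, if b < R t then 1 else -1) * inversionSign R := by
  have h1 : ∀ (x : Fin 2) (t : Fin r), Fin.castAdd r x < Fin.natAdd 2 t := fun x t => by
    simp only [Fin.lt_def, Fin.val_castAdd, Fin.val_natAdd]; omega
  have h2 : ∀ (x : Fin 2) (t : Fin r), ¬ Fin.natAdd 2 t < Fin.castAdd r x :=
    fun x t => (h1 x t).not_gt
  have h3 : ∀ s t : Fin r, Fin.natAdd 2 s < Fin.natAdd 2 t ↔ s < t := fun s t => by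
    simp
  have h4 : ∀ x y : Fin 2, Fin.castAdd r x < Fin.castAdd r y ↔ x < y := fun _ _ => Iff.rfl
  have hite : ∀ (x : Fin n) t, (if ¬ x < R t then (-1 : ℤ) else 1) = if x < R t then 1 else -1 :=
    fun x t => by split_ifs <;> rfl
  simp only [inversionSign, Fin.prod_univ_add, Fin.append_left, Fin.append_right, h1, h2, h3, h4,
    Fin.prod_univ_two, true_and, false_and, if_false, hite, cons_val_zero, cons_val_one]
  simp [hab]
  exact .inl (by congr!)

theorem coordF_orderIsoOfFin {s : Finset (Fin n)} (hs : s.card = q) {f : Fin q → Fin n}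
    (hf : Function.Injective f) (h : univ.image f = s) {ω : ExteriorAlgebra K (Fin n → K)}
    (hω : ω ∈ ⋀[K]^q (Fin n → K)) :
    coordF K q (fun a => (s.orderIsoOfFin hs a : Fin n)) ω =
      (inversionSign f : K) * coordF K q f ω := by
  have hmono : StrictMono fun a => (s.orderIsoOfFin hs a : Fin n) :=
    fun _ _ hab => (s.orderIsoOfFin hs).strictMono hab
  have himage : univ.image (fun a => (s.orderIsoOfFin hs a : Fin n)) = s := by
    ext x
    simp only [mem_image, mem_univ, true_and]
    exact ⟨fun ⟨a, ha⟩ => ha ▸ (s.orderIsoOfFin hs a).2,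
      fun hx => ⟨(s.orderIsoOfFin hs).symm ⟨x, hx⟩, by simp⟩⟩
  obtain ⟨σ, rfl⟩ := exists_perm_of_image_eq hf hmono.injective (h.trans himage.symm)
  rw [coordF_comp_perm _ σ hω, inversionSign_comp hmono, inversionSign_perm, ← mul_assoc,
    ← Int.cast_mul, ← Units.val_mul, Int.units_mul_self]
  simp

end Inversions

section Bridge

variable {K : Type*} [Field K] {n m c : ℕ}

theorem isDecomp_two_iff {y : ExteriorAlgebra K (Fin 4 → K)} (hy : y ∈ ⋀[K]^2 (Fin 4 → K)) :
    IsDecomp K 2 y ↔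
      coordF K 2 ![0, 1] y * coordF K 2 ![2, 3] y - coordF K 2 ![0, 2] y * coordF K 2 ![1, 3] y +
        coordF K 2 ![0, 3] y * coordF K 2 ![1, 2] y = 0 := by
  have key : ∀ (β : Fin 0 → Fin 2 → Fin 4) (γ : Fin 0 → Fin 4) i j,
      piF K 0 0 id β γ i j y = coordF K 2 ![i, j] y := by
    intro β γ i j
    rw [piF, Fintype.sum_unique]
    change coordF K 2 (tupleP 0 0 id β γ i j default) y = _
    congr 2
    ext x
    fin_cases x <;> rfl
  have key' : ∀ (β : Fin 0 → Fin 2 → Fin 4) (γ : Fin 0 → Fin 4), Pprime K 0 0 id β γ y =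
      coordF K 2 ![0, 1] y * coordF K 2 ![2, 3] y - coordF K 2 ![0, 2] y * coordF K 2 ![1, 3] y +
        coordF K 2 ![0, 3] y * coordF K 2 ![1, 2] y := fun β γ => by
    simp only [Pprime, key]
  constructor
  · intro h
    rw [← key' Fin.elim0 Fin.elim0]
    exact Pprime_eq_zero_of_isDecomp rfl _ _ _ h
  · intro h
    refine isDecomp_of_Pprime_eq_zero le_rfl hy fun m c α β γ hmc hABC => ?_
    obtain rfl : m = 0 := by omega
    obtain rfl : c = 0 := by omega
    obtain rfl : α = id := (hABC.2.1.range_inj strictMono_id).1 <| by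
      rw [(Finite.injective_iff_surjective.1 hABC.2.1.injective).range_eq, Set.range_id]
    rw [key', h]

variable {α : Fin 4 → Fin n} {β : Fin m → Fin 2 → Fin n} {γ : Fin c → Fin n}

theorem mem_SP {x : Fin n} :
    x ∈ SP m c α β γ ↔ (∃ a, x = α a) ∨ (∃ l, x = β l 1) ∨ ∃ s, x = γ s := by
  simp only [SP, mem_union, mem_image, mem_univ, true_and, or_assoc, eq_comm]

theorem card_SP (h : OrderedABC m c α β γ) : (SP m c α β γ).card = 2 + (m + c) + 2 := by
  have hinj := h.1.comp (Function.injective_id.sumMap (Function.Injective.sumMap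
    (f := fun l : Fin m => (l, (1 : Fin 2))) (fun _ _ h => congrArg Prod.fst h)
    (Function.injective_id (α := Fin c))))
  have : SP m c α β γ = univ.image (Sum.elim α (Sum.elim (fun x : Fin m × Fin 2 => β x.1 x.2) γ) ∘
      Sum.map id (Sum.map (fun l : Fin m => (l, (1 : Fin 2))) id)) := by
    ext x
    simp [mem_SP, eq_comm]
  rw [this, card_image_of_injective _ hinj]
  simp
  omega

theorem _root_.OrderedABC.α_ne_β (h : OrderedABC m c α β γ) (a : Fin 4) (l : Fin m) (e : Fin 2) :
    α a ≠ β l e :=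
  h.1.ne (a₁ := .inl a) (a₂ := .inr (.inl (l, e))) Sum.inl_ne_inr

theorem _root_.OrderedABC.α_ne_γ (h : OrderedABC m c α β γ) (a : Fin 4) (s : Fin c) :
    α a ≠ γ s :=
  h.1.ne (a₁ := .inl a) (a₂ := .inr (.inr s)) Sum.inl_ne_inr

theorem _root_.OrderedABC.β_ne_γ (h : OrderedABC m c α β γ) (l : Fin m) (e : Fin 2) (s : Fin c) :
    β l e ≠ γ s :=
  h.1.ne (a₁ := .inr (.inl (l, e))) (a₂ := .inr (.inr s)) (by simp)

theorem _root_.OrderedABC.β_inj (h : OrderedABC m c α β γ) {l l' : Fin m} {e e' : Fin 2}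
    (he : β l e = β l' e') : l = l' ∧ e = e' := by
  have hinj := h.1
  simpa using @hinj (.inr (.inl (l, e))) (.inr (.inl (l', e'))) he

theorem XL_apply {p : ℕ} (h : (SP m c α β γ).card = p + 2) (v : Fin n → K) (j : Fin (p + 2)) :
    XL K p m c α β γ v j = v ((SP m c α β γ).orderEmbOfFin h j) +
      ∑ l, if β l 1 = (SP m c α β γ).orderEmbOfFin h j then v (β l 0) else 0 := by
  have hX : Xmat K p m c α β γ j = fun i =>
      (if i = (SP m c α β γ).orderEmbOfFin h j then 1 else 0) +
        ∑ l, if i = β l 0 ∧ β l 1 = (SP m c α β γ).orderEmbOfFin h j then 1 else 0 :=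
    congrFun (dif_pos h : Xmat K p m c α β γ = _) j
  rw [XL, mulVecLin_apply, mulVec, hX]
  simp only [dotProduct, add_mul, sum_add_distrib, sum_mul, ite_mul, one_mul, zero_mul]
  rw [sum_comm]
  congr 1
  · simp
  · refine sum_congr rfl fun l _ => ?_
    split_ifs with hl <;> simp [hl]

theorem ZL_single {p : ℕ} (hABC : OrderedABC m c α β γ) (h : (SP m c α β γ).card = p + 2)
    (j : Fin (p + 2)) (a : Fin 4) :
    ZL K p m c α β γ (Pi.single j 1) a =
      if (SP m c α β γ).orderEmbOfFin h j = α a then 1 else 0 := by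
  have hX : ∀ x, XL K p m c α β γ (Pi.single (α a) 1) x =
      if (SP m c α β γ).orderEmbOfFin h x = α a then 1 else 0 := by
    intro x
    rw [XL_apply h, sum_eq_zero, add_zero, Pi.single_apply]
    intro l _
    rw [Pi.single_eq_of_ne (hABC.α_ne_β a l 0).symm, ite_self]
  rw [ZL, mulVecLin_apply, mulVec_single_one]
  change Zmat K p m c α β γ a j = _
  unfold Zmat
  congr 1
  refine propext ⟨fun hj => ?_, fun hj => ?_⟩
  · have := congrFun hj j
    rw [hX, Pi.single_eq_same] at this
    by_contra hne
    simp [hne] at this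
  · ext x
    rw [hX, ← hj, Pi.single_apply]
    simp

theorem coordF_map_ιMulti_two {r N M : ℕ} (hr : r = 2) (L : (Fin N → K) →ₗ[K] (Fin M → K))
    (w : Fin r → Fin N → K) (i j : Fin M) :
    coordF K 2 ![i, j] (ExteriorAlgebra.map L (ιMulti K r w)) =
      L (w (Fin.cast hr.symm 0)) i * L (w (Fin.cast hr.symm 1)) j -
        L (w (Fin.cast hr.symm 0)) j * L (w (Fin.cast hr.symm 1)) i := by
  subst hr
  rw [map_apply_ιMulti, coordF_ιMulti, det_fin_two]
  rfl

theorem coordF_GABC_eq_coordF_map {p : ℕ} (hABC : OrderedABC m c α β γ)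
    (h : (SP m c α β γ).card = p + 2) {i j : Fin 4} (hij : i < j) {s : Finset (Fin (p + 2))}
    (hs : s.card = p)
    (hsc : ∀ x, x ∈ s ↔ (SP m c α β γ).orderEmbOfFin h x ≠ α i ∧
      (SP m c α β γ).orderEmbOfFin h x ≠ α j) (ω : ExteriorAlgebra K (Fin n → K)) :
    coordF K 2 ![i, j] (GABC K p m c α β γ ω) =
      coordF K p (fun a => (s.orderIsoOfFin hs a : Fin (p + 2)))
        (ExteriorAlgebra.map (XL K p m c α β γ) ω) := by
  have hr : p + 2 - p = 2 := by omega
  have hα : α i < α j := hABC.2.1 hij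
  have hlt : ∀ (t : Finset (Fin (p + 2))) (ht : tᶜ.card = p + 2 - p),
      (tᶜ.orderIsoOfFin ht (Fin.cast hr.symm 0) : Fin (p + 2)) <
        tᶜ.orderIsoOfFin ht (Fin.cast hr.symm 1) := fun t ht =>
    (tᶜ.orderIsoOfFin ht).strictMono (by simp [Fin.lt_def])
  rw [GABC, dualAt, map_sum, map_sum, sum_eq_single ⟨s, hs⟩]
  · rw [map_smul, map_smul, coordF_map_ιMulti_two hr, smul_eq_mul]
    simp only [ZL_single hABC h]
    have hc : sᶜ.card = p + 2 - p := by rw [card_compl, hs, Fintype.card_fin]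
    have hx0 := mem_compl.1 (sᶜ.orderIsoOfFin hc (Fin.cast hr.symm 0)).2
    have hx1 := mem_compl.1 (sᶜ.orderIsoOfFin hc (Fin.cast hr.symm 1)).2
    have hx := ((SP m c α β γ).orderEmbOfFin h).strictMono (hlt s hc)
    rw [hsc, not_and_or, not_not, not_not] at hx0 hx1
    have h0 : (SP m c α β γ).orderEmbOfFin h (sᶜ.orderIsoOfFin hc (Fin.cast hr.symm 0)) = α i := by
      grind
    have h1 : (SP m c α β γ).orderEmbOfFin h (sᶜ.orderIsoOfFin hc (Fin.cast hr.symm 1)) = α j := by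
      grind
    rw [h0, h1]
    simp [hα.ne]
  · rintro ⟨t, ht⟩ - hts
    have hc : tᶜ.card = p + 2 - p := by rw [card_compl, ht, Fintype.card_fin]
    have hx := ((SP m c α β γ).orderEmbOfFin h).strictMono (hlt t hc)
    rw [map_smul, map_smul, coordF_map_ιMulti_two hr, smul_eq_mul]
    simp only [ZL_single hABC h]
    have h1 : ¬ ((SP m c α β γ).orderEmbOfFin h (tᶜ.orderIsoOfFin hc (Fin.cast hr.symm 0)) = α j ∧
        (SP m c α β γ).orderEmbOfFin h (tᶜ.orderIsoOfFin hc (Fin.cast hr.symm 1)) = α i) := by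
      grind
    have h2 : ¬ ((SP m c α β γ).orderEmbOfFin h (tᶜ.orderIsoOfFin hc (Fin.cast hr.symm 0)) = α i ∧
        (SP m c α β γ).orderEmbOfFin h (tᶜ.orderIsoOfFin hc (Fin.cast hr.symm 1)) = α j) := by
      rintro ⟨h0, h1⟩
      refine hts (Subtype.ext (eq_of_subset_of_card_le (fun x hx => ?_) (by rw [hs, ht])).symm)
      by_contra hxt
      obtain ⟨a, ha⟩ := (tᶜ.orderIsoOfFin hc).surjective ⟨x, mem_compl.2 hxt⟩
      obtain ⟨b, rfl⟩ := (finCongr hr.symm).surjective a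
      have hx' := (hsc x).1 hx
      rw [show x = tᶜ.orderIsoOfFin hc (finCongr hr.symm b) from (congrArg Subtype.val ha).symm]
        at hx'
      fin_cases b
      · exact hx'.1 h0
      · exact hx'.2 h1
    have hmul : ∀ {P Q : Prop} [Decidable P] [Decidable Q], ¬ (P ∧ Q) →
        (if P then (1 : K) else 0) * (if Q then 1 else 0) = 0 := by
      intro P Q _ _ hPQ
      split_ifs <;> simp_all
    rw [hmul h2, hmul h1, sub_zero, mul_zero]
  · simp

theorem coordF_map_XL (hABC : OrderedABC m c α β γ)
    (h : (SP m c α β γ).card = 2 + (m + c) + 2) {k l : Fin 4}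
    {u : Fin (2 + (m + c)) → Fin (2 + (m + c) + 2)}
    (hu : ∀ a, (SP m c α β γ).orderEmbOfFin h (u a) = tupleP m c α β γ k l (fun _ => 1) a)
    {ω : ExteriorAlgebra K (Fin n → K)} (hω : ω ∈ ⋀[K]^(2 + (m + c)) (Fin n → K)) :
    coordF K _ u (ExteriorAlgebra.map (XL K (2 + (m + c)) m c α β γ) ω) =
      piF K m c α β γ k l ω := by
  refine eq_of_eq_on_ιMulti (F := (coordF K _ u).comp
    (ExteriorAlgebra.map (XL K (2 + (m + c)) m c α β γ)).toLinearMap)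
    (G := piF K m c α β γ k l) (fun v => ?_) hω
  rw [LinearMap.comp_apply, AlgHom.toLinearMap_apply, map_apply_ιMulti, coordF_ιMulti, piF_ιMulti,
    ← det_transpose]
  congr 1
  ext b a
  simp only [transpose_apply, of_apply, Function.comp_apply]
  rw [XL_apply h, hu, tupleP]
  refine Fin.addCases (fun x => ?_) (fun x => ?_) b
  · simp only [Fin.append_left]
    fin_cases x <;> simp [(hABC.α_ne_β _ _ _).symm]
  · simp only [Fin.append_right]
    refine Fin.addCases (fun t => ?_) (fun t => ?_) x
    · simp only [Fin.append_left, Fin.sum_univ_two]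
      rw [sum_eq_single t, if_pos rfl, add_comm]
      · rfl
      · exact fun l _ hl => if_neg fun he => hl (hABC.β_inj he).1
      · simp
    · simp [hABC.β_ne_γ]

theorem coordF_GABC (hABC : OrderedABC m c α β γ) {i j k l : Fin 4} (hij : i < j)
    (hkl : k ≠ l) (hik : i ≠ k) (hil : i ≠ l) (hjk : j ≠ k) (hjl : j ≠ l)
    {ω : ExteriorAlgebra K (Fin n → K)} (hω : ω ∈ ⋀[K]^(2 + (m + c)) (Fin n → K)) :
    coordF K 2 ![i, j] (GABC K (2 + (m + c)) m c α β γ ω) =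
      (inversionSign (tupleP m c α β γ k l fun _ => 1) : K) * piF K m c α β γ k l ω := by
  have h := card_SP hABC
  have hinj := OrderedABC.injective_tupleP hABC.1 hkl fun _ => 1
  have hmem : ∀ a, ∃ x, (SP m c α β γ).orderEmbOfFin h x =
      tupleP m c α β γ k l (fun _ => 1) a := by
    intro a
    have : tupleP m c α β γ k l (fun _ => 1) a ∈ SP m c α β γ := by
      have := mem_image_tupleP.1 (mem_image_of_mem (tupleP m c α β γ k l fun _ => 1) (mem_univ a))
      rw [mem_SP]
      tauto
    rwa [← mem_coe, ← range_orderEmbOfFin _ h] at this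
  choose u hu using hmem
  have hcomp : (SP m c α β γ).orderEmbOfFin h ∘ u = tupleP m c α β γ k l fun _ => 1 := funext hu
  have hu_inj : Function.Injective u := .of_comp (hcomp ▸ hinj)
  have hs : (univ.image u).card = 2 + (m + c) := by
    rw [card_image_of_injective _ hu_inj, card_univ, Fintype.card_fin]
  have hω' : ExteriorAlgebra.map (XL K (2 + (m + c)) m c α β γ) ω ∈
      ⋀[K]^(2 + (m + c)) (Fin (2 + (m + c) + 2) → K) := by
    have hle : ⋀[K]^(2 + (m + c)) (Fin n → K) ≤
        (⋀[K]^(2 + (m + c)) (Fin (2 + (m + c) + 2) → K)).comap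
          (ExteriorAlgebra.map (XL K (2 + (m + c)) m c α β γ)).toLinearMap := by
      rw [← ιMulti_span_fixedDegree, Submodule.span_le]
      rintro _ ⟨v, rfl⟩
      rw [SetLike.mem_coe, Submodule.mem_comap, AlgHom.toLinearMap_apply, map_apply_ιMulti]
      exact ιMulti_range K _ ⟨_, rfl⟩
    exact hle hω
  rw [coordF_GABC_eq_coordF_map hABC h hij hs, coordF_orderIsoOfFin hs hu_inj rfl hω',
    coordF_map_XL hABC h hu hω, ← hcomp, inversionSign_comp (OrderEmbedding.strictMono _)]
  intro x
  have hx : x ∈ univ.image u ↔ (SP m c α β γ).orderEmbOfFin h x ∈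
      univ.image (tupleP m c α β γ k l fun _ => 1) := by
    rw [← hcomp, ← image_image]
    simp
  rw [hx, mem_image_tupleP]
  have hx' := mem_SP.1 (orderEmbOfFin_mem _ h x)
  generalize (SP m c α β γ).orderEmbOfFin h x = z at hx'
  have hne : ∀ {a b}, a ≠ b → α a ≠ α b := fun h => hABC.2.1.injective.ne h
  constructor
  · rintro (rfl | rfl | ⟨t, rfl⟩ | ⟨t, rfl⟩)
    · exact ⟨hne hik.symm, hne hjk.symm⟩
    · exact ⟨hne hil.symm, hne hjl.symm⟩
    · exact ⟨(hABC.α_ne_β _ _ _).symm, (hABC.α_ne_β _ _ _).symm⟩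
    · exact ⟨(hABC.α_ne_γ _ _).symm, (hABC.α_ne_γ _ _).symm⟩
  · rintro ⟨hi, hj⟩
    rcases hx' with ⟨a, rfl⟩ | hβγ
    · have hi' : a ≠ i := fun h => hi (h ▸ rfl)
      have hj' : a ≠ j := fun h => hj (h ▸ rfl)
      obtain rfl | rfl : a = k ∨ a = l := by omega
      · exact .inl rfl
      · exact .inr (.inl rfl)
    · exact .inr (.inr hβγ)

theorem GABC_mem {p : ℕ} (ω : ExteriorAlgebra K (Fin n → K)) :
    GABC K p m c α β γ ω ∈ ⋀[K]^2 (Fin 4 → K) := by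
  have key : ∀ r, r = 2 → ∀ w : Fin r → Fin 4 → K, ιMulti K r w ∈ ⋀[K]^2 (Fin 4 → K) := by
    rintro r rfl w
    exact ιMulti_range K 2 ⟨w, rfl⟩
  rw [GABC, dualAt, map_sum]
  refine Submodule.sum_mem _ fun s _ => ?_
  rw [map_smul, map_apply_ιMulti]
  exact Submodule.smul_mem _ _ (key _ (by omega) _)

theorem isDecomp_GABC_iff (hABC : OrderedABC m c α β γ) {ω : ExteriorAlgebra K (Fin n → K)}
    (hω : ω ∈ ⋀[K]^(2 + (m + c)) (Fin n → K)) :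
    IsDecomp K 2 (GABC K (2 + (m + c)) m c α β γ ω) ↔ Pprime K m c α β γ ω = 0 := by
  rw [isDecomp_two_iff (GABC_mem ω), Pprime,
    coordF_GABC hABC (i := 0) (j := 1) (k := 2) (l := 3) (by decide) (by decide) (by decide)
      (by decide) (by decide) (by decide) hω,
    coordF_GABC hABC (i := 0) (j := 2) (k := 1) (l := 3) (by decide) (by decide) (by decide)
      (by decide) (by decide) (by decide) hω,
    coordF_GABC hABC (i := 0) (j := 3) (k := 1) (l := 2) (by decide) (by decide) (by decide)
      (by decide) (by decide) (by decide) hω,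
    coordF_GABC hABC (i := 1) (j := 2) (k := 0) (l := 3) (by decide) (by decide) (by decide)
      (by decide) (by decide) (by decide) hω,
    coordF_GABC hABC (i := 1) (j := 3) (k := 0) (l := 2) (by decide) (by decide) (by decide)
      (by decide) (by decide) (by decide) hω,
    coordF_GABC hABC (i := 2) (j := 3) (k := 0) (l := 1) (by decide) (by decide) (by decide)
      (by decide) (by decide) (by decide) hω]
  let R : Fin (m + c) → Fin n := Fin.append (fun l => β l 1) γ
  let A : Fin 4 → ℤ := fun i => ∏ t, if α i < R t then 1 else -1
  have hA : ∀ i, A i * A i = 1 := fun i => by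
    simp only [A, ← prod_mul_distrib]
    exact prod_eq_one fun t _ => by split_ifs <;> rfl
  have hsign : ∀ {k l}, k < l → inversionSign (tupleP m c α β γ k l fun _ => 1) =
      A k * A l * inversionSign R := fun h => inversionSign_append_pair (hABC.2.1 h) R
  have hu : A 0 * A 1 * A 2 * A 3 * (A 0 * A 1 * A 2 * A 3) = 1 := by
    linear_combination A 1 * A 1 * A 2 * A 2 * A 3 * A 3 * hA 0 + A 2 * A 2 * A 3 * A 3 * hA 1 +
      A 3 * A 3 * hA 2 + hA 3
  have hu' := congrArg (Int.cast : ℤ → K) hu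
  have hS := congrArg (Int.cast : ℤ → K) (inversionSign_mul_self R)
  rw [hsign (k := 0) (l := 1) (by decide), hsign (k := 0) (l := 2) (by decide),
    hsign (k := 0) (l := 3) (by decide), hsign (k := 1) (l := 2) (by decide),
    hsign (k := 1) (l := 3) (by decide), hsign (k := 2) (l := 3) (by decide)]
  push_cast at hu' hS ⊢
  constructor <;> intro h0
  · linear_combination (A 0 * A 1 * A 2 * A 3 : K) * h0 -
      (piF K m c α β γ 0 1 ω * piF K m c α β γ 2 3 ω -
        piF K m c α β γ 0 2 ω * piF K m c α β γ 1 3 ω +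
        piF K m c α β γ 0 3 ω * piF K m c α β γ 1 2 ω) *
      (hS + (inversionSign R * inversionSign R : K) * hu')
  · linear_combination (A 0 * A 1 * A 2 * A 3 * (inversionSign R * inversionSign R) : K) * h0

end Bridge

end GrassmannCone

/-- For `2 ≤ p ≤ n-2`, `ω ∈ ⋀^p k^n` is indecomposable iff there is a
triple `(A,B,C)` satisfying the distinctness and ordering conditions such that
`G_{A,B,C}(ω) ∈ ⋀² k⁴` is indecomposable. -/
theorem grassmann_indecomposable_iff_exists_GCP
    {k : Type*} [Field k] {p n : ℕ} (hp : 2 ≤ p) (hpn : p ≤ n - 2)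
    (ω : ⋀[k]^p (Fin n → k)) :
    ¬ IsDecomp k p ω.val ↔
      ∃ (m c : ℕ) (α : Fin 4 → Fin n) (β : Fin m → Fin 2 → Fin n) (γ : Fin c → Fin n),
        2 + (m + c) = p ∧ OrderedABC m c α β γ ∧
          ¬ IsDecomp k 2 (GABC k p m c α β γ ω.val) := by
  constructor
  · intro hω
    by_contra h
    push Not at h
    refine hω (GrassmannCone.isDecomp_of_Pprime_eq_zero hp ω.2 ?_)
    rintro m c α β γ rfl hABC
    exact (GrassmannCone.isDecomp_GABC_iff hABC ω.2).1 (h m c α β γ rfl hABC)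
  · rintro ⟨m, c, α, β, γ, rfl, hABC, h⟩ hω
    exact h ((GrassmannCone.isDecomp_GABC_iff hABC ω.2).2
      (GrassmannCone.Pprime_eq_zero_of_isDecomp rfl α β γ hω))

end
end

section
/- Let V_0 and V_1 be p-dimensional subspaces of k^n such that q := p − dim(V_0 ∩ V_1) ≥ 2. Then there exists a triple (A,B,C) whose indices α_i, β_j^(μ), γ_l are all distinct and satisfy α_i < α_{i+1}, β_i^0 < β_i^1, β_i^ν < β_{i+1}^ν, β_i^0 < α_1, β_i^1 < α_3, γ_i < γ_{i+1}, such that, setting X = X_{A,B,C}: (i) X(V_0) and X(V_1) are p-dimensional subspaces of k^{p+2}; (ii) dim(X(V_0) ∩ X(V_1)) = p−2; and (iii) the four vectors X(e_{α_1}), X(e_{α_2}), X(e_{α_3}), X(e_{α_4}) are linearly independent modulo X(V_0) ∩ X(V_1). -/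
open ExteriorAlgebra

noncomputable section

variable (k : Type*) [Field k]

section CoordinateSubspaces

variable {k : Type*} [Field k] {n : ℕ}

/-- The coordinate subspace spanned by the basis vectors `e_i`, `i ∈ D`. -/
def coordSubspace (k : Type*) [Field k] {n : ℕ} (D : Finset (Fin n)) :
    Submodule k (Fin n → k) :=
  ⨅ i ∈ ((D : Set (Fin n))ᶜ), LinearMap.ker (LinearMap.proj i : (Fin n → k) →ₗ[k] k)

theorem mem_coordSubspace {D : Finset (Fin n)} {x : Fin n → k} :
    x ∈ coordSubspace k D ↔ ∀ i, i ∉ D → x i = 0 := by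
  simp [coordSubspace]

theorem finrank_coordSubspace (D : Finset (Fin n)) :
    Module.finrank k (coordSubspace k D) = D.card := by
  classical
  have e := LinearMap.iInfKerProjEquiv k (fun _ : Fin n => k) (I := (D : Set (Fin n)))
    (J := (D : Set (Fin n))ᶜ) disjoint_compl_right (by simp)
  rw [coordSubspace, e.finrank_eq]
  simp

theorem coordSubspace_mono {D E : Finset (Fin n)} (h : D ⊆ E) :
    coordSubspace k D ≤ coordSubspace k E := fun _ hx =>
  mem_coordSubspace.2 fun i hi => mem_coordSubspace.1 hx i fun hD => hi (h hD)

theorem single_mem_coordSubspace {D : Finset (Fin n)} {i : Fin n} (h : i ∈ D) (a : k) :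
    Pi.single i a ∈ coordSubspace k D :=
  mem_coordSubspace.2 fun j hj => Pi.single_eq_of_ne (by rintro rfl; exact hj h) _

theorem coordSubspace_le {D : Finset (Fin n)} {V : Submodule k (Fin n → k)}
    (h : ∀ i ∈ D, Pi.single i 1 ∈ V) : coordSubspace k D ≤ V := by
  intro x hx
  rw [pi_eq_sum_univ' x]
  refine V.sum_mem fun i _ => ?_
  by_cases hi : i ∈ D
  · exact V.smul_mem _ (by simpa [Pi.single_apply, eq_comm] using h i hi)
  · simp [mem_coordSubspace.1 hx i hi]

theorem single_mem_sup_of_insert {V : Submodule k (Fin n → k)} {D : Finset (Fin n)} {i : Fin n}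
    (hD : V ⊓ coordSubspace k D = ⊥) (hi : V ⊓ coordSubspace k (insert i D) ≠ ⊥) :
    Pi.single i (1 : k) ∈ V ⊔ coordSubspace k D := by
  obtain ⟨v, hv, hv0⟩ := Submodule.exists_mem_ne_zero_of_ne_bot hi
  have hvi : v i ≠ 0 := by
    intro h0
    apply hv0
    rw [← Submodule.mem_bot k, ← hD]
    refine ⟨hv.1, mem_coordSubspace.2 fun j hj => ?_⟩
    by_cases hji : j = i
    · rw [hji, h0]
    · exact mem_coordSubspace.1 hv.2 j (by simp [hji, hj])
  have h : Pi.single i (1 : k) = (v i)⁻¹ • v + (Pi.single i (1 : k) - (v i)⁻¹ • v) := by abel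
  rw [h]
  refine Submodule.add_mem_sup (V.smul_mem _ hv.1) (mem_coordSubspace.2 fun j hj => ?_)
  by_cases hji : j = i
  · subst hji; simp [hvi]
  · simp [hji, mem_coordSubspace.1 hv.2 j (by simp [hji, hj])]

theorem exists_isCompl_coordSubspace (V : Submodule k (Fin n → k)) :
    ∃ R : Finset (Fin n), IsCompl V (coordSubspace k R) := by
  classical
  obtain ⟨R, hR, hmax⟩ := Finset.exists_max_image
    (Finset.univ.filter fun R : Finset (Fin n) => V ⊓ coordSubspace k R = ⊥) Finset.card
    ⟨∅, by
      simp only [Finset.mem_filter, Finset.mem_univ, true_and, eq_bot_iff]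
      intro x hx
      exact funext fun i => mem_coordSubspace.1 hx.2 i (by simp)⟩
  simp only [Finset.mem_filter, Finset.mem_univ, true_and] at hR hmax
  refine ⟨R, disjoint_iff.2 hR, codisjoint_iff.2 (top_le_iff.1 ?_)⟩
  refine le_trans ?_ (coordSubspace_le (D := Finset.univ) fun i _ => ?_)
  · exact fun x _ => mem_coordSubspace.2 fun i hi => absurd (Finset.mem_univ i) hi
  · by_cases hi : i ∈ R
    · exact Submodule.mem_sup_right (single_mem_coordSubspace hi 1)
    · refine single_mem_sup_of_insert hR fun h => ?_
      have := hmax _ h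
      rw [Finset.card_insert_of_notMem hi] at this
      omega

/-- After projecting away a suitable set `D` of coordinates, two `p`-dimensional subspaces span
everything, a set `R₀ ∪ R₁` of coordinates is complementary to their intersection, and, unless
`R₀` and `R₁` have only two elements, the subspaces contain the coordinate vectors of `R₀`,
respectively `R₁`. -/
theorem exists_coordinate_reduction {p : ℕ} (V₀ V₁ : Submodule k (Fin n → k))
    (h0 : Module.finrank k V₀ = p) (h1 : Module.finrank k V₁ = p)
    (hq : 2 ≤ p - Module.finrank k ↥(V₀ ⊓ V₁)) :
    ∃ (m : ℕ) (D R₀ R₁ : Finset (Fin n)), Disjoint D (R₀ ∪ R₁) ∧ Disjoint R₀ R₁ ∧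
      R₀.card = m + 2 ∧ R₁.card = m + 2 ∧ D.card + (p + m + 2) = n ∧
      V₀ ⊓ coordSubspace k D = ⊥ ∧ V₁ ⊓ coordSubspace k D = ⊥ ∧
      (∀ z ∈ V₀ ⊔ coordSubspace k D, z ∈ V₁ ⊔ coordSubspace k D →
        (∀ i, i ∉ D → i ∉ R₀ → i ∉ R₁ → z i = 0) → z ∈ coordSubspace k D) ∧
      (m = 0 ∨ ((∀ i ∈ R₀, Pi.single i 1 ∈ V₀ ⊔ coordSubspace k D) ∧
        ∀ i ∈ R₁, Pi.single i 1 ∈ V₁ ⊔ coordSubspace k D)) := by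
  classical
  obtain ⟨E, hE⟩ := exists_isCompl_coordSubspace (V₀ ⊔ V₁)
  have hEbot : ∀ V ≤ V₀ ⊔ V₁, V ⊓ coordSubspace k E = ⊥ := fun V hV =>
    (hE.disjoint.mono_left hV).eq_bot
  have hEcard : E.card + (p + 2) ≤ n := by
    have e1 := Submodule.finrank_add_eq_of_isCompl hE
    have e2 := Submodule.finrank_sup_add_finrank_inf_eq V₀ V₁
    rw [finrank_coordSubspace, Module.finrank_fin_fun] at e1
    omega
  obtain ⟨D, hD, hmax⟩ := Finset.exists_max_image
    (Finset.univ.filter fun D : Finset (Fin n) => E ⊆ D ∧ V₀ ⊓ coordSubspace k D = ⊥ ∧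
      V₁ ⊓ coordSubspace k D = ⊥ ∧ D.card + (p + 2) ≤ n) Finset.card
    ⟨E, by simp [hEcard, hEbot]⟩
  simp only [Finset.mem_filter, Finset.mem_univ, true_and] at hD hmax
  obtain ⟨hED, hD0, hD1, hDcard⟩ := hD
  obtain ⟨m, hm⟩ : ∃ m, D.card + (p + m + 2) = n := ⟨n - D.card - p - 2, by omega⟩
  set W₀ := V₀ ⊔ coordSubspace k D with hW₀
  set W₁ := V₁ ⊔ coordSubspace k D with hW₁
  have hWtop : W₀ ⊔ W₁ = ⊤ := by
    rw [← top_le_iff, ← hE.codisjoint.eq_top]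
    refine sup_le (sup_le_sup le_sup_left le_sup_left) ?_
    exact (coordSubspace_mono hED).trans (le_sup_right.trans le_sup_left)
  have hrank : ∀ V : Submodule k (Fin n → k), Module.finrank k V = p →
      V ⊓ coordSubspace k D = ⊥ →
      Module.finrank k ↥(V ⊔ coordSubspace k D) = p + D.card := by
    intro V hV hVD
    have e := Submodule.finrank_sup_add_finrank_inf_eq V (coordSubspace k D)
    rw [hVD, finrank_bot, hV, finrank_coordSubspace] at e
    omega
  have hr0 := hrank V₀ h0 hD0
  have hr1 := hrank V₁ h1 hD1
  have hJ := Submodule.finrank_sup_add_finrank_inf_eq W₀ W₁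
  rw [hWtop, finrank_top, Module.finrank_fin_fun, hr0, hr1] at hJ
  obtain ⟨R, hR⟩ := exists_isCompl_coordSubspace (W₀ ⊓ W₁)
  have hRcard : R.card = 2 * (m + 2) := by
    have e := Submodule.finrank_add_eq_of_isCompl hR
    rw [finrank_coordSubspace, Module.finrank_fin_fun] at e
    omega
  have hDR : Disjoint D R := by
    rw [Finset.disjoint_left]
    intro i hiD hiR
    have hi : Pi.single i (1 : k) ∈ (W₀ ⊓ W₁) ⊓ coordSubspace k R :=
      ⟨⟨Submodule.mem_sup_right (single_mem_coordSubspace hiD 1),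
        Submodule.mem_sup_right (single_mem_coordSubspace hiD 1)⟩,
        single_mem_coordSubspace hiR 1⟩
    rw [hR.disjoint.eq_bot, Submodule.mem_bot] at hi
    simpa using congrFun hi i
  have hbound : ∀ (W : Submodule k (Fin n → k)) (T : Finset (Fin n)), T ⊆ R →
      W₀ ⊓ W₁ ≤ W → Module.finrank k W = p + D.card →
      (∀ i ∈ T, Pi.single i 1 ∈ W) → T.card ≤ m + 2 := by
    intro W T hTR hJW hW hT
    have hdis : (W₀ ⊓ W₁) ⊓ coordSubspace k T = ⊥ :=
      (hR.disjoint.mono_right (coordSubspace_mono hTR)).eq_bot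
    have e := Submodule.finrank_sup_add_finrank_inf_eq (W₀ ⊓ W₁) (coordSubspace k T)
    rw [hdis, finrank_bot, finrank_coordSubspace] at e
    have := Submodule.finrank_mono (sup_le hJW (coordSubspace_le hT))
    omega
  obtain ⟨R₀, hR₀, hR₀card, hcol⟩ : ∃ R₀ ⊆ R, R₀.card = m + 2 ∧
      (m = 0 ∨ ((∀ i ∈ R₀, Pi.single i 1 ∈ W₀) ∧ ∀ i ∈ R \ R₀, Pi.single i 1 ∈ W₁)) := by
    rcases Nat.eq_zero_or_pos m with hm0 | hmpos
    · obtain ⟨R₀, hsub, hcard⟩ := Finset.exists_subset_card_eq (s := R) (n := m + 2) (by omega)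
      exact ⟨R₀, hsub, hcard, Or.inl hm0⟩
    · have hmem : ∀ i ∈ R, Pi.single i (1 : k) ∈ W₀ ∨ Pi.single i (1 : k) ∈ W₁ := by
        intro i hi
        have hiD : i ∉ D := fun h => Finset.disjoint_left.1 hDR h hi
        by_contra! hcon
        have c0 : V₀ ⊓ coordSubspace k (insert i D) = ⊥ :=
          of_not_not fun h => hcon.1 (single_mem_sup_of_insert hD0 h)
        have c1 : V₁ ⊓ coordSubspace k (insert i D) = ⊥ :=
          of_not_not fun h => hcon.2 (single_mem_sup_of_insert hD1 h)
        have hins := Finset.card_insert_of_notMem hiD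
        have := hmax _ ⟨hED.trans (Finset.subset_insert i D), c0, c1, by omega⟩
        omega
      set T := R.filter fun i => Pi.single i (1 : k) ∈ W₀ with hT
      have hTR : T ⊆ R := Finset.filter_subset _ _
      have hT0 : ∀ i ∈ T, Pi.single i (1 : k) ∈ W₀ := fun i hi => (Finset.mem_filter.1 hi).2
      have hT1 : ∀ i ∈ R \ T, Pi.single i (1 : k) ∈ W₁ := by
        intro i hi
        rw [Finset.mem_sdiff] at hi
        exact (hmem i hi.1).resolve_left fun h => hi.2 (Finset.mem_filter.2 ⟨hi.1, h⟩)
      have b0 := hbound W₀ T hTR inf_le_left hr0 hT0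
      have b1 := hbound W₁ (R \ T) Finset.sdiff_subset inf_le_right hr1 hT1
      have := Finset.card_sdiff_add_card_eq_card hTR
      exact ⟨T, hTR, by omega, Or.inr ⟨hT0, hT1⟩⟩
  have hcard := Finset.card_sdiff_add_card_eq_card hR₀
  refine ⟨m, D, R₀, R \ R₀, by rwa [Finset.union_sdiff_of_subset hR₀], Finset.disjoint_sdiff,
    hR₀card, by omega, hm, hD0, hD1, fun z hz0 hz1 hz => ?_, hcol⟩
  obtain ⟨d, hd⟩ : ∃ d : Fin n → k, d = fun i => if i ∈ D then z i else 0 := ⟨_, rfl⟩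
  have hdD : d ∈ coordSubspace k D := mem_coordSubspace.2 fun i hi => by simp [hd, hi]
  have hzd : z - d ∈ (W₀ ⊓ W₁) ⊓ coordSubspace k R := by
    refine ⟨⟨W₀.sub_mem hz0 (Submodule.mem_sup_right hdD),
      W₁.sub_mem hz1 (Submodule.mem_sup_right hdD)⟩, mem_coordSubspace.2 fun i hi => ?_⟩
    by_cases hiD : i ∈ D
    · simp [hd, hiD]
    · simp [hd, hiD, hz i hiD (fun h => hi (hR₀ h)) (by simp [hi])]
  rw [hR.disjoint.eq_bot, Submodule.mem_bot, sub_eq_zero] at hzd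
  rwa [hzd]

end CoordinateSubspaces

/-- Two disjoint sets of `m + 2` indices contain two indices each, making up `α`, such that the
remaining indices can be paired off, each pair `β l` meeting both sets, compatibly with the
order. -/
theorem exists_ordered_pairing {n m : ℕ} {R₀ R₁ : Finset (Fin n)} (hdis : Disjoint R₀ R₁)
    (h0 : R₀.card = m + 2) (h1 : R₁.card = m + 2) :
    ∃ (α : Fin 4 → Fin n) (β : Fin m → Fin 2 → Fin n), StrictMono α ∧
      Function.Injective (fun x : Fin m × Fin 2 => β x.1 x.2) ∧
      (∀ i l ν, α i ≠ β l ν) ∧ (∀ l, β l 0 < β l 1) ∧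
      (∀ ν : Fin 2, StrictMono fun l => β l ν) ∧
      (∀ l, β l 0 < α 0) ∧ (∀ l, β l 1 < α 2) ∧ (∀ i, α i ∈ R₀ ∪ R₁) ∧
      (∀ l, (β l 0 ∈ R₀ ∧ β l 1 ∈ R₁) ∨ (β l 0 ∈ R₁ ∧ β l 1 ∈ R₀)) ∧
      ∀ i ∈ R₀ ∪ R₁, (∃ j, α j = i) ∨ ∃ l ν, β l ν = i := by
  classical
  obtain ⟨x, hx⟩ : ∃ x : Fin (m + 2) ↪o Fin n, x = R₀.orderEmbOfFin h0 := ⟨_, rfl⟩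
  obtain ⟨y, hy⟩ : ∃ y : Fin (m + 2) ↪o Fin n, y = R₁.orderEmbOfFin h1 := ⟨_, rfl⟩
  have hxR : ∀ i, x i ∈ R₀ := fun i => hx ▸ Finset.orderEmbOfFin_mem _ _ _
  have hyR : ∀ i, y i ∈ R₁ := fun i => hy ▸ Finset.orderEmbOfFin_mem _ _ _
  have hxs : ∀ i ∈ R₀, ∃ j, x j = i := fun i hi => by
    have : i ∈ Set.range x := by rw [hx, Finset.range_orderEmbOfFin]; exact hi
    exact this
  have hys : ∀ i ∈ R₁, ∃ j, y j = i := fun i hi => by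
    have : i ∈ Set.range y := by rw [hy, Finset.range_orderEmbOfFin]; exact hi
    exact this
  have hxy : ∀ i j, x i ≠ y j := fun i j h =>
    Finset.disjoint_left.1 hdis (hxR i) (h ▸ hyR j)
  have hxm : ∀ {i j}, i < j → x i < x j := fun h => x.strictMono h
  have hym : ∀ {i j}, i < j → y i < y j := fun h => y.strictMono h
  obtain ⟨s, hs⟩ : ∃ s : Fin (m + 2), s = ⟨m, by omega⟩ := ⟨_, rfl⟩
  obtain ⟨t, ht⟩ : ∃ t : Fin (m + 2), t = ⟨m + 1, by omega⟩ := ⟨_, rfl⟩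
  have hst : s < t := by simp [hs, ht]
  obtain ⟨ι, hι⟩ : ∃ ι : Fin m → Fin (m + 2), ι = fun l => ⟨l, by omega⟩ := ⟨_, rfl⟩
  have hιs : ∀ l, ι l < s := fun l => by simp [hι, hs]
  have hιt : ∀ l, ι l < t := fun l => (hιs l).trans hst
  have hιm : StrictMono ι := fun a b h => by simpa [hι] using h
  have hcov : ∀ i, i = s ∨ i = t ∨ ∃ l, ι l = i := by
    intro i
    by_cases hi : (i : ℕ) < m
    · exact Or.inr (Or.inr ⟨⟨i, hi⟩, by simp [hι]⟩)
    · rcases Nat.lt_or_ge m i with h | h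
      · exact Or.inr (Or.inl (Fin.ext (by simp [ht]; omega)))
      · exact Or.inl (Fin.ext (by simp [hs]; omega))
  obtain ⟨A, hA⟩ : ∃ A : Finset (Fin n), A = {x s, x t, y s, y t} := ⟨_, rfl⟩
  have hA4 : A.card = 4 := by
    rw [hA, Finset.card_insert_of_notMem, Finset.card_insert_of_notMem,
      Finset.card_insert_of_notMem, Finset.card_singleton] <;>
    simp [hxy, hst.ne]
  obtain ⟨α, hα⟩ : ∃ α : Fin 4 ↪o Fin n, α = A.orderEmbOfFin hA4 := ⟨_, rfl⟩
  have hαA : ∀ i, α i = x s ∨ α i = x t ∨ α i = y s ∨ α i = y t := fun i => by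
    have : α i ∈ A := hα ▸ Finset.orderEmbOfFin_mem _ _ _
    simpa [hA] using this
  have hαs : ∀ i ∈ A, ∃ j, α j = i := fun i hi => by
    have : i ∈ Set.range α := by rw [hα, Finset.range_orderEmbOfFin]; exact hi
    exact this
  have hα2 : ∀ a ∈ A, ∀ b ∈ A, a < b → a ≤ α 2 := by
    intro a ha b hb hab
    obtain ⟨i, rfl⟩ := hαs a ha
    obtain ⟨j, rfl⟩ := hαs b hb
    have hij : i < j := α.strictMono.lt_iff_lt.1 hab
    exact α.monotone (by omega)
  have hxα : x s ≤ α 2 := hα2 _ (by simp [hA]) (x t) (by simp [hA]) (hxm hst)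
  have hyα : y s ≤ α 2 := hα2 _ (by simp [hA]) (y t) (by simp [hA]) (hym hst)
  obtain ⟨β, hβ⟩ : ∃ β : Fin m → Fin 2 → Fin n,
      β = fun l => ![min (x (ι l)) (y (ι l)), max (x (ι l)) (y (ι l))] := ⟨_, rfl⟩
  have hβ0 : ∀ l, β l 0 = min (x (ι l)) (y (ι l)) := fun l => by simp [hβ]
  have hβ1 : ∀ l, β l 1 = max (x (ι l)) (y (ι l)) := fun l => by simp [hβ]
  have hβc : ∀ l, (β l 0 = x (ι l) ∧ β l 1 = y (ι l)) ∨ (β l 0 = y (ι l) ∧ β l 1 = x (ι l)) := by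
    intro l
    rw [hβ0, hβ1]
    rcases le_total (x (ι l)) (y (ι l)) with h | h
    · simp [h]
    · simp [h]
  have hβν : ∀ l ν, β l ν = x (ι l) ∨ β l ν = y (ι l) := by
    intro l ν
    fin_cases ν
    · exact (hβc l).imp And.left And.left
    · exact (hβc l).symm.imp And.right And.right
  have hβlt : ∀ l, β l 0 < β l 1 := fun l => by
    rw [hβ0, hβ1]; exact min_lt_max.2 (hxy _ _)
  have hxinj : ∀ {i j}, x i = x j ↔ i = j := x.injective.eq_iff
  have hyinj : ∀ {i j}, y i = y j ↔ i = j := y.injective.eq_iff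
  refine ⟨α, β, α.strictMono, ?_, ?_, hβlt, ?_, ?_, ?_, ?_, ?_, ?_⟩
  · rintro ⟨l, ν⟩ ⟨l', ν'⟩ h
    simp only at h
    have hl : l = l' := by
      apply hιm.injective
      rcases hβν l ν with h1 | h1 <;> rcases hβν l' ν' with h2 | h2 <;> rw [h1, h2] at h
      · exact hxinj.1 h
      · exact absurd h (hxy _ _)
      · exact absurd h.symm (hxy _ _)
      · exact hyinj.1 h
    subst hl
    have hmono : StrictMono (β l) := Fin.strictMono_iff_lt_succ.2 fun i => by
      rw [Subsingleton.elim i 0]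
      exact hβlt l
    rw [hmono.injective h]
  · intro i l ν h
    have a := (hιs l).ne'
    have b := (hιt l).ne'
    rcases hαA i with h1 | h1 | h1 | h1 <;> rcases hβν l ν with h2 | h2 <;> rw [h1, h2] at h
    · exact a (hxinj.1 h)
    · exact hxy _ _ h
    · exact b (hxinj.1 h)
    · exact hxy _ _ h
    · exact hxy _ _ h.symm
    · exact a (hyinj.1 h)
    · exact hxy _ _ h.symm
    · exact b (hyinj.1 h)
  · intro ν a b hab
    have h1 := hxm (hιm hab)
    have h2 := hym (hιm hab)
    fin_cases ν
    · exact (hβ0 a).trans_lt ((min_lt_min h1 h2).trans_eq (hβ0 b).symm)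
    · exact (hβ1 a).trans_lt ((max_lt_max h1 h2).trans_eq (hβ1 b).symm)
  · intro l
    rw [hβ0]
    rcases hαA 0 with h | h | h | h <;> rw [h]
    · exact min_lt_of_left_lt (hxm (hιs l))
    · exact min_lt_of_left_lt (hxm (hιt l))
    · exact min_lt_of_right_lt (hym (hιs l))
    · exact min_lt_of_right_lt (hym (hιt l))
  · intro l
    rw [hβ1]
    exact max_lt ((hxm (hιs l)).trans_le hxα) ((hym (hιs l)).trans_le hyα)
  · intro i
    rw [Finset.mem_union]
    rcases hαA i with h | h | h | h <;> simp [h, hxR, hyR]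
  · intro l
    rcases hβc l with h | h <;> simp [h, hxR, hyR]
  · intro i hi
    rcases Finset.mem_union.1 hi with hi | hi
    · obtain ⟨j, rfl⟩ := hxs i hi
      rcases hcov j with rfl | rfl | ⟨l, rfl⟩
      · exact Or.inl (hαs _ (by simp [hA]))
      · exact Or.inl (hαs _ (by simp [hA]))
      · rcases hβc l with h | h
        · exact Or.inr ⟨l, 0, h.1⟩
        · exact Or.inr ⟨l, 1, h.2⟩
    · obtain ⟨j, rfl⟩ := hys i hi
      rcases hcov j with rfl | rfl | ⟨l, rfl⟩
      · exact Or.inl (hαs _ (by simp [hA]))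
      · exact Or.inl (hαs _ (by simp [hA]))
      · rcases hβc l with h | h
        · exact Or.inr ⟨l, 1, h.2⟩
        · exact Or.inr ⟨l, 0, h.1⟩

section CollapseMap

variable {k : Type*} [Field k] {p n m c : ℕ} {α : Fin 4 → Fin n} {β : Fin m → Fin 2 → Fin n}
  {γ : Fin c → Fin n}

theorem card_SP (h : Function.Injective
    (Sum.elim α (Sum.elim (fun x : Fin m × Fin 2 => β x.1 x.2) γ))) :
    (SP m c α β γ).card = 4 + m + c := by
  have hα : Function.Injective α := fun i j hij => by simpa using @h (.inl i) (.inl j) hij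
  have hβ : Function.Injective fun l => β l 1 := fun i j hij => by
    simpa using @h (.inr (.inl (i, 1))) (.inr (.inl (j, 1))) hij
  have hγ : Function.Injective γ := fun i j hij => by
    simpa using @h (.inr (.inr i)) (.inr (.inr j)) hij
  have hαβ : ∀ i l, α i ≠ β l 1 := fun i l e => by
    simpa using @h (.inl i) (.inr (.inl (l, 1))) e
  have hαγ : ∀ i l, α i ≠ γ l := fun i l e => by
    simpa using @h (.inl i) (.inr (.inr l)) e
  have hβγ : ∀ i l, β i 1 ≠ γ l := fun i l e => by
    simpa using @h (.inr (.inl (i, 1))) (.inr (.inr l)) e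
  rw [SP, Finset.card_union_of_disjoint, Finset.card_union_of_disjoint,
    Finset.card_image_of_injective _ hα, Finset.card_image_of_injective _ hβ,
    Finset.card_image_of_injective _ hγ]
  · simp
  · rw [Finset.disjoint_left]
    simp only [Finset.mem_image, Finset.mem_univ, true_and]
    rintro _ ⟨i, rfl⟩ ⟨l, e⟩
    exact hαβ i l e.symm
  · rw [Finset.disjoint_left]
    simp only [Finset.mem_image, Finset.mem_univ, true_and, Finset.mem_union]
    rintro _ (⟨i, rfl⟩ | ⟨i, rfl⟩) ⟨l, e⟩
    · exact hαγ i l e.symm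
    · exact hβγ i l e.symm

theorem apply_add_sum_eq_zero_of_XL_eq_zero (hS : (SP m c α β γ).card = p + 2) {v : Fin n → k}
    (hv : XL k p m c α β γ v = 0) {s : Fin n} (hs : s ∈ SP m c α β γ) :
    v s + ∑ l, (if β l 1 = s then v (β l 0) else 0) = 0 := by
  classical
  obtain ⟨j, hj⟩ := ((SP m c α β γ).orderIsoOfFin hS).surjective ⟨s, hs⟩
  have hentry : ∀ i, Xmat k p m c α β γ j i =
      (if i = s then 1 else 0) + ∑ l, if i = β l 0 ∧ β l 1 = s then 1 else 0 := by
    intro i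
    refine (congrFun (congrFun (dif_pos hS) j) i).trans ?_
    simp only [hj]
  have h : ∑ i, Xmat k p m c α β γ j i * v i = 0 := congrFun hv j
  simp only [hentry, add_mul, Finset.sum_add_distrib, Finset.sum_mul] at h
  rw [Finset.sum_comm] at h
  refine Eq.trans ?_ h
  congr 1
  · simp
  · refine Finset.sum_congr rfl fun l _ => ?_
    by_cases e : β l 1 = s <;> simp [e]

theorem XL_eq_zero_imp (hp : 2 + (m + c) = p) (h : Function.Injective
    (Sum.elim α (Sum.elim (fun x : Fin m × Fin 2 => β x.1 x.2) γ))) {v : Fin n → k}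
    (hv : XL k p m c α β γ v = 0) :
    (∀ i, v (α i) = 0) ∧ (∀ l, v (γ l) = 0) ∧ ∀ l, v (β l 1) = - v (β l 0) := by
  have hS : (SP m c α β γ).card = p + 2 := by rw [card_SP h]; omega
  have hβ : ∀ i j, β i 1 = β j 1 ↔ i = j := fun i j =>
    ⟨fun e => by simpa using @h (.inr (.inl (i, 1))) (.inr (.inl (j, 1))) e, fun e => by rw [e]⟩
  have hαβ : ∀ i l, β l 1 ≠ α i := fun i l e => by
    simpa using @h (.inr (.inl (l, 1))) (.inl i) e
  have hβγ : ∀ i l, β i 1 ≠ γ l := fun i l e => by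
    simpa using @h (.inr (.inl (i, 1))) (.inr (.inr l)) e
  refine ⟨fun i => ?_, fun l => ?_, fun l => ?_⟩
  · simpa [hαβ] using apply_add_sum_eq_zero_of_XL_eq_zero hS hv (s := α i) (by simp [SP])
  · simpa [hβγ] using apply_add_sum_eq_zero_of_XL_eq_zero hS hv (s := γ l) (by simp [SP])
  · rw [eq_neg_iff_add_eq_zero]
    simpa [hβ] using apply_add_sum_eq_zero_of_XL_eq_zero hS hv (s := β l 1) (by simp [SP])

end CollapseMap

/-- If `W₀ ⊇ e_{R₀}`, `W₁ ⊇ e_{R₁}` and no vector of `W₀ ⊓ W₁` is supported on `R₀ ∪ R₁` modulo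
`D`, then vectors of `W₀` supported on `D ∪ R₀ ∪ R₁` vanish on `R₁`. -/
theorem apply_eq_zero_of_mem_of_single_mem {k : Type*} [Field k] {n : ℕ}
    {W₀ W₁ : Submodule k (Fin n → k)} {D R₀ R₁ : Finset (Fin n)} (hDR : Disjoint D R₁)
    (hDW : coordSubspace k D ≤ W₀)
    (hJ : ∀ z ∈ W₀, z ∈ W₁ → (∀ i, i ∉ D → i ∉ R₀ → i ∉ R₁ → z i = 0) → z ∈ coordSubspace k D)
    (h0 : ∀ i ∈ R₀, Pi.single i 1 ∈ W₀) (h1 : ∀ i ∈ R₁, Pi.single i 1 ∈ W₁)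
    {z : Fin n → k} (hz : z ∈ W₀) (hzC : ∀ i, i ∉ D → i ∉ R₀ → i ∉ R₁ → z i = 0) :
    ∀ i ∈ R₁, z i = 0 := by
  classical
  obtain ⟨y, hy⟩ : ∃ y : Fin n → k, y = fun i => if i ∈ R₁ then z i else 0 := ⟨_, rfl⟩
  have hyR : y ∈ coordSubspace k R₁ := mem_coordSubspace.2 fun i hi => by simp [hy, hi]
  have hzy : z - y ∈ coordSubspace k (D ∪ R₀) := by
    refine mem_coordSubspace.2 fun i hi => ?_
    rw [Finset.mem_union, not_or] at hi
    by_cases hi1 : i ∈ R₁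
    · simp [hy, hi1]
    · simp [hy, hi1, hzC i hi.1 hi.2 hi1]
  have hle : coordSubspace k (D ∪ R₀) ≤ W₀ := coordSubspace_le fun i hi =>
    (Finset.mem_union.1 hi).elim (fun h => hDW (single_mem_coordSubspace h 1)) (h0 i)
  have hyW : y ∈ W₀ := by
    have := W₀.sub_mem hz (hle hzy)
    rwa [sub_sub_cancel] at this
  have hyD := hJ y hyW (coordSubspace_le h1 hyR) fun i _ _ hi => by simp [hy, hi]
  intro i hi
  have := mem_coordSubspace.1 hyD i (fun h => Finset.disjoint_left.1 hDR h hi)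
  simpa [hy, hi] using this

/-- If `V₀, V₁` are `p`-dimensional subspaces of `k^n` with
`q = p - dim (V₀ ⊓ V₁) ≥ 2`, then there is an ordered triple `(A,B,C)` such that, with
`X = X_{A,B,C}`, the images `X(V₀), X(V₁)` are `p`-dimensional, their intersection has
dimension `p-2`, and the vectors `X(e_{α_i})` are linearly independent modulo
`X(V₀) ⊓ X(V₁)`. -/
theorem exists_ordered_triple_of_subspaces
    {k : Type*} [Field k] {p n : ℕ} (V₀ V₁ : Submodule k (Fin n → k))
    (h0 : Module.finrank k V₀ = p) (h1 : Module.finrank k V₁ = p)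
    (hq : 2 ≤ p - Module.finrank k ↥(V₀ ⊓ V₁)) :
    ∃ (m c : ℕ) (α : Fin 4 → Fin n) (β : Fin m → Fin 2 → Fin n) (γ : Fin c → Fin n),
      2 + (m + c) = p ∧ OrderedABC m c α β γ ∧
      Module.finrank k ↥(V₀.map (XL k p m c α β γ)) = p ∧
      Module.finrank k ↥(V₁.map (XL k p m c α β γ)) = p ∧
      Module.finrank k
        ↥((V₀.map (XL k p m c α β γ)) ⊓ (V₁.map (XL k p m c α β γ))) = p - 2 ∧
      LinearIndependent k fun i : Fin 4 =>
        ((V₀.map (XL k p m c α β γ)) ⊓ (V₁.map (XL k p m c α β γ))).mkQ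
          (XL k p m c α β γ (Pi.single (α i) 1)) := by
  classical
  obtain ⟨m, D, R₀, R₁, hDR, hR, hR0, hR1, hm, hD0, hD1, hJ, hcol⟩ :=
    exists_coordinate_reduction V₀ V₁ h0 h1 hq
  obtain ⟨α, β, hα, hβinj, hαβ, hβlt, hβm, hβα, hβα', hαR, hβR, hcov⟩ :=
    exists_ordered_pairing hR hR0 hR1
  obtain ⟨C, hC⟩ : ∃ C : Finset (Fin n), C = (D ∪ (R₀ ∪ R₁))ᶜ := ⟨_, rfl⟩
  have hCR : ∀ i, i ∉ D → i ∉ R₀ → i ∉ R₁ → i ∈ C := fun i a b d => by simp [hC, a, b, d]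
  have hcard : 2 + (m + C.card) = p := by
    have e := Finset.card_add_card_compl (D ∪ (R₀ ∪ R₁))
    rw [← hC, Finset.card_union_of_disjoint hDR, Finset.card_union_of_disjoint hR,
      Fintype.card_fin] at e
    omega
  obtain ⟨γ, hγ⟩ : ∃ γ : Fin C.card ↪o Fin n, γ = C.orderEmbOfFin rfl := ⟨_, rfl⟩
  have hγC : ∀ l, γ l ∈ C := fun l => hγ ▸ Finset.orderEmbOfFin_mem _ _ _
  have hγs : ∀ i ∈ C, ∃ j, γ j = i := fun i hi => by
    have : i ∈ Set.range γ := by rw [hγ, Finset.range_orderEmbOfFin]; exact hi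
    exact this
  have hCnot : ∀ i ∈ R₀ ∪ R₁, i ∉ C := fun i hi h => by
    rw [hC, Finset.mem_compl] at h
    exact h (Finset.mem_union_right _ hi)
  have hβR' : ∀ l ν, β l ν ∈ R₀ ∪ R₁ := fun l ν => by
    rw [Finset.mem_union]
    fin_cases ν <;> rcases hβR l with h | h <;> simp [h]
  have hinj : Function.Injective
      (Sum.elim α (Sum.elim (fun x : Fin m × Fin 2 => β x.1 x.2) γ)) := by
    refine hα.injective.sumElim (hβinj.sumElim γ.injective ?_) ?_
    · exact fun a b e => hCnot _ (hβR' a.1 a.2) (e ▸ hγC b)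
    · rintro a (b | b) e
      · exact hαβ a b.1 b.2 e
      · exact hCnot _ (hαR a) (e ▸ hγC b)
  refine ⟨m, C.card, α, β, γ, hcard,
    ⟨hinj, hα, hβlt, hβm, hβα, hβα', γ.strictMono⟩, ?_⟩
  obtain ⟨X, hX⟩ : ∃ X, X = XL k p m C.card α β γ := ⟨_, rfl⟩
  rw [← hX]
  have hker : ∀ v, X v = 0 →
      (∀ i, v (α i) = 0) ∧ (∀ i ∈ C, v i = 0) ∧ ∀ l, v (β l 1) = - v (β l 0) := by
    intro v hv
    obtain ⟨a, b, d⟩ := XL_eq_zero_imp hcard hinj (hX ▸ hv)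
    exact ⟨a, fun i hi => (hγs i hi).elim fun j hj => hj ▸ b j, d⟩
  have hJ' : ∀ z ∈ V₁ ⊔ coordSubspace k D, z ∈ V₀ ⊔ coordSubspace k D →
      (∀ i, i ∉ D → i ∉ R₁ → i ∉ R₀ → z i = 0) → z ∈ coordSubspace k D :=
    fun z a b d => hJ z b a fun i e f g => d i e g f
  have hDR0 : Disjoint D R₀ := hDR.mono_right Finset.subset_union_left
  have hDR1 : Disjoint D R₁ := hDR.mono_right Finset.subset_union_right
  have hdiff : ∀ u ∈ coordSubspace k (Finset.univ.image α), ∀ v, X v = X u →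
      (v ∈ V₀ ∨ v ∈ V₁) → v - u ∈ coordSubspace k D := by
    intro u hu v hvu hv
    obtain ⟨hα0, hC0, hβ0⟩ := hker (v - u) (by rw [map_sub, hvu, sub_self])
    have huα : ∀ i, (∀ j, α j ≠ i) → u i = 0 := fun i hi =>
      mem_coordSubspace.1 hu i (by simpa using hi)
    have hvC : ∀ i ∈ C, v i = 0 := fun i hi => by
      simpa [huα i fun j e => hCnot _ (hαR j) (e ▸ hi)] using hC0 i hi
    have huβ : ∀ l ν, u (β l ν) = 0 := fun l ν => huα _ fun j => hαβ j l ν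
    have hvβ : ∀ l, v (β l 1) = - v (β l 0) := fun l => by simpa [huβ] using hβ0 l
    have hvβ0 : ∀ l, v (β l 0) = 0 := by
      intro l
      obtain ⟨c0, c1⟩ := hcol.resolve_left (Fin.pos l).ne'
      rcases hv with hv | hv
      · have hv1 := apply_eq_zero_of_mem_of_single_mem hDR1 le_sup_right hJ c0 c1
          (Submodule.mem_sup_left hv) fun i a b d => hvC i (hCR i a b d)
        rcases hβR l with h | h
        · exact neg_eq_zero.1 (hvβ l ▸ hv1 _ h.2)
        · exact hv1 _ h.1
      · have hv1 := apply_eq_zero_of_mem_of_single_mem hDR0 le_sup_right hJ' c1 c0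
          (Submodule.mem_sup_left hv) fun i a b d => hvC i (hCR i a d b)
        rcases hβR l with h | h
        · exact hv1 _ h.1
        · exact neg_eq_zero.1 (hvβ l ▸ hv1 _ h.2)
    refine mem_coordSubspace.2 fun i hi => ?_
    by_cases hiR : i ∈ R₀ ∪ R₁
    · rcases hcov i hiR with ⟨j, rfl⟩ | ⟨l, ν, rfl⟩
      · exact hα0 j
      · fin_cases ν <;> simp [huβ, hvβ, hvβ0]
    · rw [Finset.mem_union, not_or] at hiR
      exact hC0 i (hCR i hi hiR.1 hiR.2)
  have hrank : ∀ V : Submodule k (Fin n → k), (∀ v ∈ V, v ∈ V₀ ∨ v ∈ V₁) →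
      V ⊓ coordSubspace k D = ⊥ → Module.finrank k (V.map X) = Module.finrank k V := by
    intro V hV hVD
    have hi : Function.Injective (X.domRestrict V) := by
      rw [← LinearMap.ker_eq_bot, LinearMap.ker_eq_bot']
      refine fun v hv => Subtype.ext ?_
      have h := hdiff 0 (Submodule.zero_mem _) v (by simpa using hv) (hV v v.2)
      have h' : (v : Fin n → k) ∈ V ⊓ coordSubspace k D := ⟨v.2, by simpa using h⟩
      rwa [hVD, Submodule.mem_bot] at h'
    rw [← LinearMap.finrank_range_of_inj hi, LinearMap.range_domRestrict]
  have hX0 : Module.finrank k (V₀.map X) = p := (hrank V₀ (fun _ => Or.inl) hD0).trans h0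
  have hX1 : Module.finrank k (V₁.map X) = p := (hrank V₁ (fun _ => Or.inr) hD1).trans h1
  have hli : LinearIndependent k fun i : Fin 4 =>
      ((V₀.map X) ⊓ (V₁.map X)).mkQ (X (Pi.single (α i) 1)) := by
    rw [Fintype.linearIndependent_iff]
    intro g hg
    obtain ⟨u, hu⟩ : ∃ u : Fin n → k, u = ∑ i, g i • Pi.single (α i) (1 : k) := ⟨_, rfl⟩
    have huα : u ∈ coordSubspace k (Finset.univ.image α) := by
      rw [hu]
      exact Submodule.sum_mem _ fun i _ =>
        Submodule.smul_mem _ _ (single_mem_coordSubspace (by simp) 1)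
    have hXu : X u ∈ (V₀.map X) ⊓ (V₁.map X) := by
      rw [← Submodule.ker_mkQ ((V₀.map X) ⊓ (V₁.map X)), LinearMap.mem_ker, ← hg, hu]
      simp only [map_sum, map_smul]
    obtain ⟨⟨v, hv, hvu⟩, ⟨w, hw, hwu⟩⟩ := hXu
    have hmem : ∀ (V : Submodule k (Fin n → k)) (v : Fin n → k), v ∈ V →
        v - u ∈ coordSubspace k D → u ∈ V ⊔ coordSubspace k D := fun V v hv h => by
      have := Submodule.sub_mem _ (Submodule.mem_sup_left hv) (Submodule.mem_sup_right (S := V) h)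
      rwa [sub_sub_cancel] at this
    have huD := hJ u (hmem V₀ v hv (hdiff u huα v hvu (Or.inl hv)))
      (hmem V₁ w hw (hdiff u huα w hwu (Or.inr hw))) fun i _ a b =>
        mem_coordSubspace.1 huα i fun h => by
          obtain ⟨j, -, rfl⟩ := Finset.mem_image.1 h
          exact (Finset.mem_union.1 (hαR j)).elim a b
    intro i
    have h := mem_coordSubspace.1 huD (α i) fun h => Finset.disjoint_left.1 hDR h (hαR i)
    simpa [hu, Finset.sum_apply, Pi.single_apply, hα.injective.eq_iff] using h
  refine ⟨hX0, hX1, ?_, hli⟩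
  have e1 := Submodule.finrank_sup_add_finrank_inf_eq (V₀.map X) (V₁.map X)
  have e2 := Submodule.finrank_le ((V₀.map X) ⊔ (V₁.map X))
  have e3 := hli.fintype_card_le_finrank
  have e4 := ((V₀.map X) ⊓ (V₁.map X)).finrank_quotient_add_finrank
  rw [Module.finrank_fin_fun] at e2 e4
  rw [Fintype.card_fin] at e3
  omega

end
end
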